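/- Let u : ℝⁿ → ℝ be η-strongly convex for some η > 0. Then for every ε > 0 and every η̃ with 0 < η̃ < η, there exists an η̃-strongly convex function v ∈ C²(ℝⁿ) such that the Lebesgue measure of {x ∈ ℝⁿ : u(x) ≠ v(x)} is less than ε. -/

import Mathlib

open MeasureTheory Metric Set Filter
open scoped ENNReal

/-- `u : ℝⁿ → ℝ` is `η`-strongly convex: `x ↦ u x - (η/2)‖x‖²` is convex. -/
def StronglyConvexWith {n : ℕ} (η : ℝ) (u : EuclideanSpace ℝ (Fin n) → ℝ) : Prop :=
  ConvexOn ℝ Set.univ (fun x => u x - η / 2 * ‖x‖ ^ 2)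

open scoped Topology InnerProductSpace

set_option maxSynthPendingDepth 3
set_option linter.unusedSectionVars false

/-- A finite convex function on a finite-dimensional space has a supporting affine function at
every point. -/
theorem ConvexOn.exists_le_add_clm {V : Type*} [NormedAddCommGroup V] [NormedSpace ℝ V]
    [FiniteDimensional ℝ V] {f : V → ℝ} (hf : ConvexOn ℝ univ f) (x : V) :
    ∃ l : V →L[ℝ] ℝ, ∀ y, f x + l (y - x) ≤ f y := by
  have hc : Continuous f := hf.locallyLipschitz.continuous
  have hconv : Convex ℝ {p : V × ℝ | f p.1 < p.2} := by
    simpa using hf.convex_strict_epigraph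
  have hop : IsOpen {p : V × ℝ | f p.1 < p.2} :=
    isOpen_lt (hc.comp continuous_fst) continuous_snd
  obtain ⟨L, hL⟩ := geometric_hahn_banach_point_open hconv hop
    (x := ((x, f x) : V × ℝ)) (by simp)
  have hsplit : ∀ y t, L (y, t) = L (y, 0) + t * L (0, 1) := by
    intro y t
    have : ((y, t) : V × ℝ) = (y, 0) + t • (0, 1) := by simp
    rw [this, map_add, map_smul, smul_eq_mul]
  have hpos : 0 < L (0, 1) := by
    have h := hL (x, f x + 1) (by simp)
    rw [hsplit x (f x), hsplit x (f x + 1)] at h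
    linarith
  have hle : ∀ y, L (x, 0) + f x * L (0, 1) ≤ L (y, 0) + f y * L (0, 1) := by
    intro y
    refine le_of_forall_pos_lt_add fun e he => ?_
    have h := hL (y, f y + e / L (0, 1)) (by simp [he, hpos])
    rw [hsplit x (f x), hsplit y (_ + _), add_mul, div_mul_cancel₀ _ hpos.ne'] at h
    linarith
  refine ⟨-(L (0, 1))⁻¹ • L.comp (ContinuousLinearMap.inl ℝ V ℝ), fun y => ?_⟩
  have h := hle y
  have e : L (y - x, 0) = L (y, 0) - L (x, 0) := by
    rw [← map_sub]; simp
  simp only [FunLike.coe_smul, Pi.smul_apply, ContinuousLinearMap.coe_comp,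
    Function.comp_apply, ContinuousLinearMap.inl_apply, smul_eq_mul, e]
  have : f x * L (0, 1) - f y * L (0, 1) ≤ L (y, 0) - L (x, 0) := by linarith
  have h2 : (f x - f y) ≤ (L (0, 1))⁻¹ * (L (y, 0) - L (x, 0)) := by
    rw [inv_mul_eq_div, le_div_iff₀ hpos]; linarith
  linarith

section Alexandrov

variable {E : Type*} [NormedAddCommGroup E] [InnerProductSpace ℝ E]

/-- `ξ` is an `η`-strong subgradient of `u` at `y`. -/
def IsStrongSubgradient (η : ℝ) (u : E → ℝ) (ξ y : E) : Prop :=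
  ∀ z, u y + ⟪ξ, z - y⟫_ℝ + η / 2 * ‖z - y‖ ^ 2 ≤ u z

theorem IsStrongSubgradient.mul_norm_sq_le {η : ℝ} {u : E → ℝ} {ξ y ξ' y' : E}
    (h : IsStrongSubgradient η u ξ y) (h' : IsStrongSubgradient η u ξ' y') :
    η * ‖y - y'‖ ^ 2 ≤ ⟪ξ - ξ', y - y'⟫_ℝ := by
  have h1 := h y'
  have h2 := h' y
  have e1 : ⟪ξ, y' - y⟫_ℝ = -⟪ξ, y - y'⟫_ℝ := by rw [← inner_neg_right, neg_sub]
  rw [inner_sub_left]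
  rw [norm_sub_rev y' y, e1] at h1
  linarith

variable [FiniteDimensional ℝ E] {η : ℝ} {u : E → ℝ}

theorem exists_isStrongSubgradient_at
    (hu : ConvexOn ℝ univ fun x => u x - η / 2 * ‖x‖ ^ 2) (y : E) :
    ∃ ξ, IsStrongSubgradient η u ξ y := by
  obtain ⟨l, hl⟩ := hu.exists_le_add_clm y
  refine ⟨(InnerProductSpace.toDual ℝ E).symm l + η • y, fun z => ?_⟩
  have h := hl z
  rw [inner_add_left, InnerProductSpace.toDual_symm_apply, real_inner_smul_left]
  have e := norm_add_sq_real y (z - y)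
  rw [add_sub_cancel] at e
  rw [e] at h
  linarith

theorem exists_isStrongSubgradient (hη : 0 < η)
    (hu : ConvexOn ℝ univ fun x => u x - η / 2 * ‖x‖ ^ 2) (ξ : E) :
    ∃ y, IsStrongSubgradient η u ξ y := by
  have hcont : Continuous u := by
    have := hu.locallyLipschitz.continuous
    have h2 : Continuous fun x : E => (u x - η / 2 * ‖x‖ ^ 2) + η / 2 * ‖x‖ ^ 2 :=
      this.add (by fun_prop)
    simpa using h2
  obtain ⟨ξ₀, h₀⟩ := exists_isStrongSubgradient_at hu 0
  set w : E → ℝ := fun z => u z - ⟪ξ, z⟫_ℝ with hw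
  have hwc : Continuous w := hcont.sub (by fun_prop)
  have hlow : ∀ z, u 0 + (η / 2 * ‖z‖ - ‖ξ₀ - ξ‖) * ‖z‖ ≤ w z := by
    intro z
    have h := h₀ z
    rw [sub_zero] at h
    have h1 := abs_le.1 (abs_real_inner_le_norm (ξ₀ - ξ) z)
    rw [inner_sub_left] at h1
    simp only [hw]
    nlinarith
  have htend : Tendsto w (cocompact E) atTop := by
    refine tendsto_atTop_mono hlow (tendsto_atTop_add_const_left _ _ ?_)
    have hn : Tendsto (fun z : E => ‖z‖) (cocompact E) atTop := tendsto_norm_cocompact_atTop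
    exact (tendsto_atTop_add_const_right _ _ (hn.const_mul_atTop (by positivity))).atTop_mul_atTop₀
      hn
  obtain ⟨y, hy⟩ := hwc.exists_forall_le htend
  refine ⟨y, fun z => ?_⟩
  have key : ∀ t : ℝ, 0 < t → t < 1 →
      u y + ⟪ξ, z - y⟫_ℝ + η / 2 * (1 - t) * ‖z - y‖ ^ 2 ≤ u z := by
    intro t ht0 ht1
    have hc := hu.2 (mem_univ y) (mem_univ z) (sub_nonneg.2 ht1.le) ht0.le (by ring)
    have hm := hy ((1 - t) • y + t • z)
    simp only [hw, inner_add_right, real_inner_smul_right] at hm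
    simp only [smul_eq_mul] at hc
    have e1 : ‖(1 - t) • y + t • z‖ ^ 2 =
        (1 - t) * ‖y‖ ^ 2 + t * ‖z‖ ^ 2 - t * (1 - t) * ‖z - y‖ ^ 2 := by
      rw [norm_add_sq_real, norm_sub_sq_real, norm_smul, norm_smul, real_inner_smul_left,
        real_inner_smul_right, mul_pow, mul_pow, Real.norm_eq_abs, Real.norm_eq_abs, sq_abs,
        sq_abs, real_inner_comm y z]
      ring
    rw [e1] at hc
    rw [inner_sub_right]
    have : t * (u y + (⟪ξ, z⟫_ℝ - ⟪ξ, y⟫_ℝ) + η / 2 * (1 - t) * ‖z - y‖ ^ 2) ≤ t * u z := by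
      nlinarith
    exact le_of_mul_le_mul_left this ht0
  have hlim : Tendsto (fun t : ℝ => u y + ⟪ξ, z - y⟫_ℝ + η / 2 * (1 - t) * ‖z - y‖ ^ 2)
      (𝓝[>] 0) (𝓝 (u y + ⟪ξ, z - y⟫_ℝ + η / 2 * (1 - 0) * ‖z - y‖ ^ 2)) := by
    refine Tendsto.mono_left (Continuous.tendsto ?_ 0) nhdsWithin_le_nhds
    fun_prop
  have := le_of_tendsto hlim (by
    filter_upwards [Ioo_mem_nhdsGT (zero_lt_one' ℝ)] with t ht using key t ht.1 ht.2)
  simpa using this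

/-- A function on `[0, 1]` whose increments are at most quadratic plus a linear error. -/
theorem abs_sub_le_of_quadratic_increments {d : ℝ → ℝ} {c e : ℝ}
    (h : ∀ s t, 0 ≤ s → s ≤ t → t ≤ 1 → |d t - d s| ≤ c * (t - s) ^ 2 + e * (t - s)) :
    |d 1 - d 0| ≤ e := by
  have key : ∀ n : ℕ, |d 1 - d 0| ≤ c * (1 / ((n : ℝ) + 1)) + e := by
    intro n
    have hn : (0 : ℝ) < (n : ℝ) + 1 := by positivity
    have hsum := Finset.sum_range_sub (fun i : ℕ => d (i / ((n : ℝ) + 1))) (n + 1)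
    have e1 : (((n + 1 : ℕ) : ℝ)) / ((n : ℝ) + 1) = 1 := by
      push_cast; exact div_self hn.ne'
    rw [e1] at hsum
    simp only [Nat.cast_zero, zero_div] at hsum
    rw [← hsum]
    refine (Finset.abs_sum_le_sum_abs _ _).trans ?_
    have hb : ∀ i ∈ Finset.range (n + 1),
        |d (((i + 1 : ℕ) : ℝ) / ((n : ℝ) + 1)) - d ((i : ℝ) / ((n : ℝ) + 1))| ≤
          c * (1 / ((n : ℝ) + 1)) ^ 2 + e * (1 / ((n : ℝ) + 1)) := by
      intro i hi
      have hi' : (i : ℝ) + 1 ≤ n + 1 := by exact_mod_cast Finset.mem_range.1 hi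
      have hd : ((i + 1 : ℕ) : ℝ) / ((n : ℝ) + 1) - (i : ℝ) / ((n : ℝ) + 1) =
          1 / ((n : ℝ) + 1) := by
        push_cast; ring
      have := h ((i : ℝ) / ((n : ℝ) + 1)) (((i + 1 : ℕ) : ℝ) / ((n : ℝ) + 1)) (by positivity)
        (by rw [← sub_nonneg, hd]; positivity) (by rw [div_le_one hn]; push_cast; exact hi')
      rwa [hd] at this
    refine (Finset.sum_le_sum hb).trans ?_
    rw [Finset.sum_const, Finset.card_range, nsmul_eq_mul]
    push_cast
    apply le_of_eq
    field_simp
  have hlim : Tendsto (fun n : ℕ => c * (1 / ((n : ℝ) + 1)) + e) atTop (𝓝 (c * 0 + e)) :=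
    (tendsto_one_div_add_atTop_nhds_zero_nat.const_mul c).add_const e
  have := ge_of_tendsto' hlim key
  simpa using this

end Alexandrov

section Alexandrov

variable {E : Type*} [NormedAddCommGroup E] [InnerProductSpace ℝ E]
variable {η : ℝ} {u : E → ℝ}

/-- Subgradients depend differentiably on the base point wherever the inverse map `G` has an
invertible derivative. -/
theorem IsStrongSubgradient.norm_sub_symm_le {G : E → E} (hη : 0 < η)
    (hG : ∀ ξ, IsStrongSubgradient η u ξ (G ξ)) {ξ : E} {B : E ≃L[ℝ] E}
    (hB : HasFDerivAt G (B : E →L[ℝ] E) ξ) {ε : ℝ} (hε : 0 < ε) :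
    ∃ δ > 0, ∀ h ζ, ‖h‖ ≤ δ → IsStrongSubgradient η u ζ (G ξ + h) →
      ‖ζ - ξ - B.symm h‖ ≤ ε * ‖h‖ := by
  have huniq : ∀ ζ y, IsStrongSubgradient η u ζ y → G ζ = y := by
    intro ζ y h
    have := (hG ζ).mul_norm_sq_le h
    rw [sub_self, inner_zero_left] at this
    have h2 : ‖G ζ - y‖ ^ 2 ≤ 0 := by
      by_contra! hc
      nlinarith [mul_pos hη hc]
    have h3 : ‖G ζ - y‖ = 0 := by nlinarith [norm_nonneg (G ζ - y)]
    exact sub_eq_zero.1 (norm_eq_zero.1 h3)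
  set b : ℝ := ‖(B.symm : E →L[ℝ] E)‖ + 1 with hb
  have hb0 : 0 < b := by positivity
  have hBs : ∀ v, ‖B.symm v‖ ≤ b * ‖v‖ := fun v =>
    ((B.symm : E →L[ℝ] E).le_opNorm v).trans
      (mul_le_mul_of_nonneg_right (by simp [hb]) (norm_nonneg _))
  have hlo : ∀ e > 0, ∃ ρ > 0, ∀ k, ‖k‖ ≤ ρ → ‖G (ξ + k) - G ξ - B k‖ ≤ e * ‖k‖ := by
    intro e he
    have := (hasFDerivAt_iff_isLittleO_nhds_zero.1 hB).def he
    obtain ⟨ρ, hρ, h⟩ := Metric.eventually_nhds_iff.1 this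
    refine ⟨ρ / 2, by positivity, fun k hk => h ?_⟩
    rw [dist_zero_right]; linarith
  set c : ℝ := 1 / (2 * b) with hc
  have hc0 : 0 < c := by positivity
  obtain ⟨ρ₀, hρ₀, hρ⟩ := hlo c hc0
  have hgrow : ∀ k, ‖k‖ ≤ ρ₀ → c * ‖k‖ ≤ ‖G (ξ + k) - G ξ‖ := by
    intro k hk
    have h1 := hρ k hk
    have h2 : ‖k‖ ≤ b * ‖B k‖ := by simpa using hBs (B k)
    have h3 : 2 * c * ‖k‖ ≤ ‖B k‖ := by
      have : 2 * c = 1 / b := by rw [hc]; field_simp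
      rw [this, one_div, inv_mul_eq_div, div_le_iff₀ hb0]; linarith
    have h4 := norm_sub_norm_le (B k) (B k - (G (ξ + k) - G ξ))
    rw [sub_sub_cancel, norm_sub_rev (B k)] at h4
    linarith
  have hclose : ∀ h ζ, ‖h‖ < η * c ^ 2 * ρ₀ → IsStrongSubgradient η u ζ (G ξ + h) →
      ‖ζ - ξ‖ ≤ ρ₀ ∧ c * ‖ζ - ξ‖ ≤ ‖h‖ := by
    intro h ζ hh hζ
    have hle : ‖ζ - ξ‖ ≤ ρ₀ := by
      by_contra! hgt
      set k := ζ - ξ with hk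
      have hk0 : 0 < ‖k‖ := hρ₀.trans hgt
      set t := ρ₀ / ‖k‖ with ht
      have ht0 : 0 < t := by positivity
      have ht1 : t < 1 := (div_lt_one hk0).2 hgt
      have htk : ‖t • k‖ = ρ₀ := by
        rw [norm_smul, Real.norm_of_nonneg ht0.le, ht, div_mul_cancel₀ _ hk0.ne']
      set h' := G (ξ + t • k) - G ξ with hh'
      have m1 := hζ.mul_norm_sq_le (hG (ξ + t • k))
      have m2 := (hG (ξ + t • k)).mul_norm_sq_le (hG ξ)
      have e1 : ζ - (ξ + t • k) = (1 - t) • k := by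
        rw [sub_smul, one_smul, hk]; abel
      have e2 : G ξ + h - G (ξ + t • k) = h - h' := by rw [hh']; abel
      rw [e1, e2, real_inner_smul_left, inner_sub_right] at m1
      rw [add_sub_cancel_left, real_inner_smul_left, ← hh'] at m2
      have m3 : ⟪k, h'⟫_ℝ ≤ ⟪k, h⟫_ℝ := by
        have : 0 ≤ (1 - t) * (⟪k, h⟫_ℝ - ⟪k, h'⟫_ℝ) :=
          le_trans (by positivity) m1
        linarith [nonneg_of_mul_nonneg_right this (sub_pos.2 ht1)]
      have m4 := hgrow _ htk.le
      rw [htk, ← hh'] at m4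
      have m5 : η * (c * ρ₀) ^ 2 ≤ t * (‖k‖ * ‖h‖) := by
        calc η * (c * ρ₀) ^ 2 ≤ η * ‖h'‖ ^ 2 := by gcongr
          _ ≤ t * ⟪k, h'⟫_ℝ := m2
          _ ≤ t * (‖k‖ * ‖h‖) := by
            gcongr
            exact m3.trans (real_inner_le_norm _ _)
      have m6 : t * (‖k‖ * ‖h‖) = ρ₀ * ‖h‖ := by rw [ht]; field_simp
      rw [m6] at m5
      have : ρ₀ * (η * c ^ 2 * ρ₀) ≤ ρ₀ * ‖h‖ := by linarith
      linarith [le_of_mul_le_mul_left this hρ₀]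
    refine ⟨hle, ?_⟩
    have := hgrow _ hle
    rwa [add_sub_cancel, huniq ζ _ hζ, add_sub_cancel_left] at this
  obtain ⟨ρ₁, hρ₁, hρ1⟩ := hlo (ε * c / b) (by positivity)
  refine ⟨min (η * c ^ 2 * ρ₀ / 2) (c * ρ₁), by positivity, fun h ζ hh hζ => ?_⟩
  have hpos : 0 < η * c ^ 2 * ρ₀ := by positivity
  obtain ⟨-, h2⟩ := hclose h ζ ((hh.trans (min_le_left _ _)).trans_lt (by linarith)) hζ
  have h3 : ‖ζ - ξ‖ ≤ ρ₁ :=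
    le_of_mul_le_mul_left (h2.trans (hh.trans (min_le_right _ _))) hc0
  have h4 := hρ1 _ h3
  rw [add_sub_cancel, huniq ζ _ hζ, add_sub_cancel_left] at h4
  have e : ζ - ξ - B.symm h = -B.symm (h - B (ζ - ξ)) := by
    rw [map_sub, B.symm_apply_apply, neg_sub]
  rw [e, norm_neg]
  calc _ ≤ b * ‖h - B (ζ - ξ)‖ := hBs _
    _ ≤ b * (ε * c / b * ‖ζ - ξ‖) := by gcongr
    _ = ε * (c * ‖ζ - ξ‖) := by field_simp
    _ ≤ ε * ‖h‖ := by gcongr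

/-- A second-order expansion follows from a first-order expansion of the subgradients. -/
theorem IsStrongSubgradient.abs_taylor_le (hη : 0 ≤ η) {x ξ : E} {A : E → E} {ε δ : ℝ}
    (hA : ∀ (t : ℝ) h, A (t • h) = t • A h)
    (hsub : ∀ y, ∃ ζ, IsStrongSubgradient η u ζ y) (hε : 0 ≤ ε)
    (hδ : ∀ h ζ, ‖h‖ ≤ δ → IsStrongSubgradient η u ζ (x + h) → ‖ζ - ξ - A h‖ ≤ ε * ‖h‖)
    {h : E} (hh : ‖h‖ ≤ δ) :
    |u (x + h) - u x - ⟪ξ, h⟫_ℝ - 1 / 2 * ⟪A h, h⟫_ℝ| ≤ ε * ‖h‖ ^ 2 := by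
  have hcor : ∀ t, 0 ≤ t → t ≤ 1 → ∀ ζ, IsStrongSubgradient η u ζ (x + t • h) →
      |⟪ζ, h⟫_ℝ - ⟪ξ, h⟫_ℝ - t * ⟪A h, h⟫_ℝ| ≤ ε * ‖h‖ ^ 2 := by
    intro t ht0 ht1 ζ hζ
    have hn : ‖t • h‖ ≤ ‖h‖ := by
      rw [norm_smul, Real.norm_of_nonneg ht0]
      exact mul_le_of_le_one_left (norm_nonneg _) ht1
    have h1 := hδ (t • h) ζ (hn.trans hh) hζ
    rw [hA] at h1
    rw [← inner_sub_left, ← real_inner_smul_left, ← inner_sub_left]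
    refine (abs_real_inner_le_norm _ _).trans ?_
    have := h1.trans (mul_le_mul_of_nonneg_left hn hε)
    nlinarith [norm_nonneg h]
  have key := abs_sub_le_of_quadratic_increments
    (d := fun t => u (x + t • h) - t * ⟪ξ, h⟫_ℝ - 1 / 2 * t ^ 2 * ⟪A h, h⟫_ℝ)
    (c := 1 / 2 * |⟪A h, h⟫_ℝ|) (e := ε * ‖h‖ ^ 2) (by
      intro s t hs hst ht
      obtain ⟨ζs, hζs⟩ := hsub (x + s • h)
      obtain ⟨ζt, hζt⟩ := hsub (x + t • h)
      have b1 := abs_le.1 (hcor s hs (hst.trans ht) ζs hζs)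
      have b2 := abs_le.1 (hcor t (hs.trans hst) ht ζt hζt)
      have i1 := hζs (x + t • h)
      have i2 := hζt (x + s • h)
      have e1 : x + t • h - (x + s • h) = (t - s) • h := by rw [sub_smul]; abel
      have e2 : x + s • h - (x + t • h) = (-(t - s)) • h := by rw [neg_smul, sub_smul]; abel
      rw [e1, real_inner_smul_right] at i1
      rw [e2, real_inner_smul_right] at i2
      have p1 : 0 ≤ η / 2 * ‖(t - s) • h‖ ^ 2 := by positivity
      have p2 : 0 ≤ η / 2 * ‖(-(t - s)) • h‖ ^ 2 := by positivity
      have hts : 0 ≤ t - s := sub_nonneg.2 hst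
      have q := abs_le.1 (le_refl |⟪A h, h⟫_ℝ|)
      have q1 := mul_le_mul_of_nonneg_left q.1 (sq_nonneg (t - s))
      have q2 := mul_le_mul_of_nonneg_left q.2 (sq_nonneg (t - s))
      have r1 := mul_le_mul_of_nonneg_left b1.1 hts
      have r2 := mul_le_mul_of_nonneg_left b2.2 hts
      rw [abs_le]
      constructor <;> nlinarith)
  simp only [one_smul, zero_smul, add_zero] at key
  convert key using 2
  ring

variable [FiniteDimensional ℝ E] [MeasurableSpace E] [BorelSpace E]

theorem LipschitzWith.addHaar_image_eq_zero (μ : Measure E) [μ.IsAddHaarMeasure] {K : NNReal}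
    {G : E → E} (hG : LipschitzWith K G) {s : Set E} (hs : μ s = 0) : μ (G '' s) = 0 := by
  have h1 : (μ : Measure E) ≪ Measure.hausdorffMeasure (Module.finrank ℝ E : ℝ) :=
    Measure.absolutelyContinuous_isAddHaarMeasure _ _
  have h2 : Measure.hausdorffMeasure (Module.finrank ℝ E : ℝ) ≪ (μ : Measure E) :=
    Measure.absolutelyContinuous_isAddHaarMeasure _ _
  refine h1 (le_antisymm ((hG.hausdorffMeasure_image_le (by positivity) s).trans ?_) bot_le)
  rw [h2 hs, mul_zero]

/-- **Alexandrov's theorem** for strongly convex functions. -/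
theorem alexandrov_of_stronglyConvex (μ : Measure E) [μ.IsAddHaarMeasure] (hη : 0 < η)
    (hu : ConvexOn ℝ univ fun x => u x - η / 2 * ‖x‖ ^ 2) :
    ∀ᵐ x ∂μ, ∃ (ξ : E →L[ℝ] ℝ) (Q : E →L[ℝ] E →L[ℝ] ℝ), ∀ ε > 0, ∃ δ > 0, ∀ h, ‖h‖ ≤ δ →
      |u (x + h) - u x - ξ h - 1 / 2 * Q h h| ≤ ε * ‖h‖ ^ 2 := by
  choose G hG using exists_isStrongSubgradient hη hu
  have hsub := exists_isStrongSubgradient_at hu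
  have hLip : LipschitzWith (Real.toNNReal η⁻¹) G := by
    refine LipschitzWith.of_dist_le_mul fun ξ ξ' => ?_
    rw [dist_eq_norm, dist_eq_norm, Real.coe_toNNReal _ (by positivity), inv_mul_eq_div,
      le_div_iff₀ hη]
    have h1 := ((hG ξ).mul_norm_sq_le (hG ξ')).trans (real_inner_le_norm _ _)
    rcases (norm_nonneg (G ξ - G ξ')).eq_or_lt with h0 | h0
    · rw [← h0, zero_mul]; positivity
    · refine le_of_mul_le_mul_right ?_ h0
      linarith
  set N : Set E := {ξ | ¬DifferentiableAt ℝ G ξ}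
  have hN : μ (G '' N) = 0 := hLip.addHaar_image_eq_zero μ (hLip.ae_differentiableAt (μ := μ))
  set Z : Set E := {ξ | DifferentiableAt ℝ G ξ ∧ (fderiv ℝ G ξ).det = 0}
  have hZ : μ (G '' Z) = 0 :=
    addHaar_image_eq_zero_of_det_fderivWithin_eq_zero μ (f' := fderiv ℝ G)
      (fun ξ hξ => hξ.1.hasFDerivAt.hasFDerivWithinAt) (fun ξ hξ => hξ.2)
  filter_upwards [measure_eq_zero_iff_ae_notMem.1 hN, measure_eq_zero_iff_ae_notMem.1 hZ]
    with x hx1 hx2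
  obtain ⟨ξ, hξ⟩ := hsub x
  have hGξ : G ξ = x := by
    have := (hG ξ).mul_norm_sq_le hξ
    rw [sub_self, inner_zero_left] at this
    have h2 : ‖G ξ - x‖ ^ 2 ≤ 0 := by
      by_contra! hc
      nlinarith [mul_pos hη hc]
    exact sub_eq_zero.1 (norm_eq_zero.1 (by nlinarith [norm_nonneg (G ξ - x)]))
  have hd : DifferentiableAt ℝ G ξ := by
    by_contra hc
    exact hx1 ⟨ξ, hc, hGξ⟩
  have hdet : (fderiv ℝ G ξ).det ≠ 0 := fun hc => hx2 ⟨ξ, ⟨hd, hc⟩, hGξ⟩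
  set B := (fderiv ℝ G ξ).toContinuousLinearEquivOfDetNeZero hdet with hBdef
  have hB : HasFDerivAt G (B : E →L[ℝ] E) ξ := by
    rw [hBdef, ContinuousLinearMap.coe_toContinuousLinearEquivOfDetNeZero]
    exact hd.hasFDerivAt
  refine ⟨innerSL ℝ ξ, (innerSL ℝ).comp (B.symm : E →L[ℝ] E), fun ε hε => ?_⟩
  obtain ⟨δ, hδ, h⟩ := IsStrongSubgradient.norm_sub_symm_le hη hG hB hε
  refine ⟨δ, hδ, fun k hk => ?_⟩
  rw [hGξ] at h
  exact IsStrongSubgradient.abs_taylor_le hη.le (A := B.symm) (fun t h => by simp) hsub hε.le h hk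

end Alexandrov

/-- An Egorov-type selection of a large closed set. -/
theorem exists_isClosed_forall_mem_of_ae {E : Type*} [NormedAddCommGroup E] [ProperSpace E]
    [MeasurableSpace E] [BorelSpace E] (μ : Measure E) [IsFiniteMeasureOnCompacts μ]
    {F : ℕ → ℕ → Set E} (hF : ∀ j k, IsClosed (F j k)) (hmono : ∀ j, Monotone (F j))
    (hae : ∀ j, ∀ᵐ x ∂μ, ∃ k, x ∈ F j k) {ε : ℝ≥0∞} (hε : ε ≠ 0) :
    ∃ φ : ℕ → ℕ, StrictMono φ ∧ ∃ K : Set E, IsClosed K ∧ μ Kᶜ < ε ∧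
      ∀ x ∈ K, ∀ j : ℕ, ‖x‖ < j → x ∈ F j (φ j) := by
  obtain ⟨ε', hε', hsum⟩ := ENNReal.exists_pos_sum_of_countable' hε ℕ
  have hev : ∀ j : ℕ, ∀ᶠ k in atTop, μ (ball 0 (j : ℝ) \ F j k) < ε' j := by
    intro j
    have hanti : Antitone fun k => ball (0 : E) (j : ℝ) \ F j k :=
      fun a b hab => sdiff_subset_sdiff_right (hmono j hab)
    have hlim := tendsto_measure_iInter_atTop (μ := μ)
      (s := fun k => ball (0 : E) (j : ℝ) \ F j k)
      (fun k => (isOpen_ball.measurableSet.diff (hF j k).measurableSet).nullMeasurableSet)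
      hanti ⟨0, ((measure_mono sdiff_subset).trans_lt measure_ball_lt_top).ne⟩
    have h0 : μ (⋂ k, ball (0 : E) (j : ℝ) \ F j k) = 0 := by
      refine measure_mono_null ?_ (hae j)
      intro x hx ⟨k, hk⟩
      exact (mem_iInter.1 hx k).2 hk
    rw [h0] at hlim
    exact hlim.eventually (gt_mem_nhds (hε' j))
  obtain ⟨φ, hφ, h⟩ := extraction_forall_of_eventually hev
  refine ⟨φ, hφ, ⋂ j : ℕ, (F j (φ j) ∪ (ball 0 (j : ℝ))ᶜ),
    isClosed_iInter fun j => (hF _ _).union isOpen_ball.isClosed_compl, ?_, ?_⟩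
  · rw [compl_iInter]
    refine (measure_iUnion_le _).trans_lt ((ENNReal.tsum_le_tsum fun j => ?_).trans_lt hsum)
    refine le_trans (measure_mono ?_) (h j).le
    intro x hx
    simp only [compl_union, compl_compl] at hx
    exact ⟨hx.2, hx.1⟩
  · intro x hx j hj
    rcases mem_iInter.1 hx j with h | h
    · exact h
    · exact absurd (mem_ball_zero_iff.2 hj) h

section Taylor

variable {E : Type*} [NormedAddCommGroup E] [InnerProductSpace ℝ E]

/-- The remainder of a second-order polynomial approximation. -/
noncomputable def taylorRem (u : E → ℝ) (x : E) (ξ : E →L[ℝ] ℝ) (Q : E →L[ℝ] E →L[ℝ] ℝ)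
    (h : E) : ℝ :=
  u (x + h) - u x - ξ h - 1 / 2 * Q h h

theorem eq_of_taylorRem_le {u : E → ℝ} {x : E} {ξ ξ' : E →L[ℝ] ℝ} {Q Q' : E →L[ℝ] E →L[ℝ] ℝ}
    (hT : ∀ ε > 0, ∃ δ > 0, ∀ h, ‖h‖ ≤ δ → |taylorRem u x ξ Q h| ≤ ε * ‖h‖ ^ 2)
    {e δ : ℝ} (hδ : 0 < δ)
    (h' : ∀ h, ‖h‖ ≤ δ → |taylorRem u x ξ' Q' h| ≤ e * ‖h‖ ^ 2) (h : E) :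
    ξ' h = ξ h ∧ |1 / 2 * (Q' h h - Q h h)| ≤ e * ‖h‖ ^ 2 := by
  have key : ∀ a > 0, ∀ᶠ t : ℝ in 𝓝[>] 0,
      |(ξ' h - ξ h) + t * (1 / 2 * (Q' h h - Q h h))| ≤ t * ((e + a) * ‖h‖ ^ 2) := by
    intro a ha
    obtain ⟨δ', hδ', hT'⟩ := hT a ha
    have hlim : Tendsto (fun t : ℝ => ‖t • h‖) (𝓝[>] 0) (𝓝 0) := by
      refine Tendsto.mono_left ?_ nhdsWithin_le_nhds
      have : Continuous fun t : ℝ => ‖t • h‖ := by fun_prop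
      simpa using this.tendsto 0
    filter_upwards [hlim.eventually (ge_mem_nhds (lt_min hδ hδ')), self_mem_nhdsWithin]
      with t ht ht0
    have ht0 : 0 < t := ht0
    have h1 := abs_le.1 (hT' _ (ht.trans (min_le_right _ _)))
    have h2 := abs_le.1 (h' _ (ht.trans (min_le_left _ _)))
    simp only [taylorRem, map_smul, smul_eq_mul, FunLike.coe_smul, Pi.smul_apply,
      norm_smul, Real.norm_of_nonneg ht0.le] at h1 h2
    have : t * |(ξ' h - ξ h) + t * (1 / 2 * (Q' h h - Q h h))| ≤
        t * (t * ((e + a) * ‖h‖ ^ 2)) := by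
      have e0 : ∀ X : ℝ, t * |X| = |t * X| := fun X => by rw [abs_mul, abs_of_pos ht0]
      rw [e0, abs_le]
      constructor <;> nlinarith
    exact le_of_mul_le_mul_left this ht0
  have hξ : ξ' h = ξ h := by
    have hc1 : Tendsto (fun t : ℝ => |(ξ' h - ξ h) + t * (1 / 2 * (Q' h h - Q h h))|)
        (𝓝[>] 0) (𝓝 |(ξ' h - ξ h) + 0 * (1 / 2 * (Q' h h - Q h h))|) :=
      (Continuous.tendsto (by fun_prop) 0).mono_left nhdsWithin_le_nhds
    have hc2 : Tendsto (fun t : ℝ => t * ((e + 1) * ‖h‖ ^ 2))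
        (𝓝[>] 0) (𝓝 (0 * ((e + 1) * ‖h‖ ^ 2))) :=
      (Continuous.tendsto (by fun_prop) 0).mono_left nhdsWithin_le_nhds
    have := le_of_tendsto_of_tendsto hc1 hc2 (key 1 one_pos)
    simp only [zero_mul, add_zero] at this
    exact sub_eq_zero.1 (abs_nonpos_iff.1 this)
  refine ⟨hξ, ?_⟩
  have hle : ∀ a > 0, |1 / 2 * (Q' h h - Q h h)| ≤ (e + a) * ‖h‖ ^ 2 := by
    intro a ha
    obtain ⟨t, ht, ht0⟩ := ((key a ha).and self_mem_nhdsWithin).exists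
    have ht0 : 0 < t := ht0
    rw [hξ, sub_self, zero_add, abs_mul, abs_of_pos ht0] at ht
    exact le_of_mul_le_mul_left ht ht0
  have hc : Tendsto (fun a : ℝ => (e + a) * ‖h‖ ^ 2) (𝓝[>] 0) (𝓝 ((e + 0) * ‖h‖ ^ 2)) :=
    (Continuous.tendsto (by fun_prop) 0).mono_left nhdsWithin_le_nhds
  have := ge_of_tendsto hc (by filter_upwards [self_mem_nhdsWithin] with a ha using hle a ha)
  simpa using this

variable [FiniteDimensional ℝ E]

theorem isClosed_exists_taylorRem_le {u : E → ℝ} (hu : Continuous u) (R δ e : ℝ) :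
    IsClosed {x | ∃ (ξ : E →L[ℝ] ℝ) (Q : E →L[ℝ] E →L[ℝ] ℝ), ‖ξ‖ ≤ R ∧ ‖Q‖ ≤ R ∧
      ∀ h, ‖h‖ ≤ δ → |taylorRem u x ξ Q h| ≤ e * ‖h‖ ^ 2} := by
  have : ProperSpace (E →L[ℝ] ℝ) := FiniteDimensional.proper_real _
  have : ProperSpace (E →L[ℝ] E →L[ℝ] ℝ) := FiniteDimensional.proper_real (E →L[ℝ] E →L[ℝ] ℝ)
  have hC : IsClosed {p : E ×
      ((closedBall (0 : E →L[ℝ] ℝ) R) × (closedBall (0 : E →L[ℝ] E →L[ℝ] ℝ) R)) | ∀ h, ‖h‖ ≤ δ →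
      |taylorRem u p.1 p.2.1 p.2.2 h| ≤ e * ‖h‖ ^ 2} := by
    simp only [ofPred_forall]
    refine isClosed_iInter fun h => isClosed_iInter fun _ => isClosed_le ?_ continuous_const
    unfold taylorRem
    have c1 : Continuous fun p : E ×
        ((closedBall (0 : E →L[ℝ] ℝ) R) × (closedBall (0 : E →L[ℝ] E →L[ℝ] ℝ) R)) =>
        (p.2.1 : E →L[ℝ] ℝ) h := by fun_prop
    have c2 : Continuous fun p : E ×
        ((closedBall (0 : E →L[ℝ] ℝ) R) × (closedBall (0 : E →L[ℝ] E →L[ℝ] ℝ) R)) =>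
        (p.2.2 : E →L[ℝ] E →L[ℝ] ℝ) h h := by fun_prop
    fun_prop
  convert isClosedMap_fst_of_compactSpace _ hC using 1
  ext x
  constructor
  · rintro ⟨ξ, Q, hξ, hQ, h⟩
    exact ⟨(x, ⟨ξ, mem_closedBall_zero_iff.2 hξ⟩,
      ⟨Q, mem_closedBall_zero_iff (E := E →L[ℝ] E →L[ℝ] ℝ) |>.2 hQ⟩), h, rfl⟩
  · rintro ⟨⟨x, ξ, Q⟩, h, rfl⟩
    exact ⟨ξ, Q, mem_closedBall_zero_iff.1 ξ.2,
      mem_closedBall_zero_iff (E := E →L[ℝ] E →L[ℝ] ℝ) |>.1 Q.2, h⟩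

theorem isClosed_second_difference_le {u : E → ℝ} (hu : Continuous u) (R M : ℝ) :
    IsClosed {x | ∀ h : E, ‖h‖ ≤ R → u (x + h) + u (x - h) - 2 * u x ≤ M * ‖h‖ ^ 2} := by
  simp only [ofPred_forall]
  exact isClosed_iInter fun h => isClosed_iInter fun _ => isClosed_le (by fun_prop)
    continuous_const

theorem exists_second_difference_le {u : E → ℝ} (hu : Continuous u) {x : E}
    {ξ : E →L[ℝ] ℝ} {Q : E →L[ℝ] E →L[ℝ] ℝ} {δ e : ℝ} (hδ : 0 < δ)
    (h : ∀ h, ‖h‖ ≤ δ → |taylorRem u x ξ Q h| ≤ e * ‖h‖ ^ 2) (R : ℝ) :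
    ∃ M, ∀ h : E, ‖h‖ ≤ R → u (x + h) + u (x - h) - 2 * u x ≤ M * ‖h‖ ^ 2 := by
  have hc : Continuous fun h : E => u (x + h) + u (x - h) - 2 * u x := by fun_prop
  obtain ⟨C, hC⟩ := (isCompact_closedBall (0 : E) R).exists_bound_of_continuousOn hc.continuousOn
  refine ⟨max (‖Q‖ + 2 * e) (|C| / δ ^ 2), fun v hv => ?_⟩
  rcases le_total ‖v‖ δ with hvδ | hvδ
  · have h1 := abs_le.1 (h v hvδ)
    have h2 := abs_le.1 (h (-v) (by rwa [norm_neg]))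
    simp only [taylorRem, map_neg, norm_neg, FunLike.coe_neg, Pi.neg_apply, neg_neg,
      ← sub_eq_add_neg] at h1 h2
    have h3 : Q v v ≤ ‖Q‖ * ‖v‖ ^ 2 := by
      have := (le_abs_self _).trans (Q.le_opNorm₂ v v)
      nlinarith
    calc _ ≤ (‖Q‖ + 2 * e) * ‖v‖ ^ 2 := by nlinarith
      _ ≤ _ := by gcongr; exact le_max_left _ _
  · have h1 := (le_abs_self _).trans (hC v (by simpa using hv))
    calc _ ≤ |C| := h1.trans (le_abs_self C)
      _ = |C| / δ ^ 2 * δ ^ 2 := by field_simp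
      _ ≤ |C| / δ ^ 2 * ‖v‖ ^ 2 := by gcongr
      _ ≤ _ := by gcongr; exact le_max_right _ _

variable [MeasurableSpace E] [BorelSpace E]

/-- A function which is almost everywhere twice differentiable in the Peano sense has uniform
expansions on a closed set with complement of small measure. -/
theorem exists_isClosed_uniform_taylor [Nontrivial E] (μ : Measure E) [μ.IsAddHaarMeasure]
    {u : E → ℝ} (hu : Continuous u)
    (hA : ∀ᵐ x ∂μ, ∃ (ξ : E →L[ℝ] ℝ) (Q : E →L[ℝ] E →L[ℝ] ℝ), ∀ ε > 0, ∃ δ > 0, ∀ h, ‖h‖ ≤ δ →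
      |taylorRem u x ξ Q h| ≤ ε * ‖h‖ ^ 2) {ε : ℝ≥0∞} (hε : ε ≠ 0) :
    ∃ K : Set E, IsClosed K ∧ μ Kᶜ < ε ∧ (0 : E) ∉ K ∧
      ∃ (J : ℕ → ℕ) (M : ℕ → ℝ) (ξ : E → E →L[ℝ] ℝ) (Q : E → E →L[ℝ] E →L[ℝ] ℝ),
        Tendsto J atTop atTop ∧ Monotone J ∧ (∀ k, J (k + 1) ≤ J k + 1) ∧ (∀ m, 0 ≤ M m) ∧
        ∀ x ∈ K,
          (∀ m : ℕ, ‖x‖ < m → ∀ h, |Q x h h| ≤ M m * ‖h‖ ^ 2) ∧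
          (∀ m : ℕ, ‖x‖ < m → ∀ h, ‖h‖ ≤ 4 →
            u (x + h) + u (x - h) - 2 * u x ≤ M m * ‖h‖ ^ 2) ∧
          ∀ k, ‖x‖ < J k → ∀ h, ‖h‖ ≤ 4 * (1 / 2) ^ k →
            |taylorRem u x (ξ x) (Q x) h| ≤ (1 / ((J k : ℝ) + 1)) ^ 3 * ‖h‖ ^ 2 := by
  set e : ℕ → ℝ := fun j => 1 / 2 * (1 / ((j : ℝ) + 1)) ^ 3 with he
  have he0 : ∀ j, 0 < e j := fun j => by simp only [he]; positivity
  set F : ℕ → ℕ → Set E := fun j k =>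
    {x | ∃ (ξ : E →L[ℝ] ℝ) (Q : E →L[ℝ] E →L[ℝ] ℝ), ‖ξ‖ ≤ (k : ℝ) ∧ ‖Q‖ ≤ (k : ℝ) ∧
      ∀ h, ‖h‖ ≤ 4 * (1 / 2 : ℝ) ^ k → |taylorRem u x ξ Q h| ≤ e j * ‖h‖ ^ 2} ∩
    {x | ∀ h : E, ‖h‖ ≤ 4 → u (x + h) + u (x - h) - 2 * u x ≤ (k : ℝ) * ‖h‖ ^ 2} with hFdef
  have hF : ∀ j k, IsClosed (F j k) := fun j k =>
    (isClosed_exists_taylorRem_le hu _ _ _).inter (isClosed_second_difference_le hu _ _)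
  have hmono : ∀ j, Monotone (F j) := by
    rintro j k l hkl x ⟨⟨ξ, Q, hξ, hQ, h⟩, h2⟩
    have hkl' : (k : ℝ) ≤ l := by exact_mod_cast hkl
    refine ⟨⟨ξ, Q, hξ.trans hkl', hQ.trans hkl', fun v hv => h v (hv.trans ?_)⟩,
      fun v hv => (h2 v hv).trans (by gcongr)⟩
    exact mul_le_mul_of_nonneg_left
      (pow_le_pow_of_le_one (by norm_num) (by norm_num) hkl) (by norm_num)
  have hae : ∀ j, ∀ᵐ x ∂μ, ∃ k, x ∈ F j k := by
    intro j
    filter_upwards [hA] with x ⟨ξ, Q, hx⟩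
    obtain ⟨δ, hδ, h⟩ := hx (e j) (he0 j)
    obtain ⟨M, hM⟩ := exists_second_difference_le hu hδ h 4
    have hp : Tendsto (fun k : ℕ => 4 * (1 / 2 : ℝ) ^ k) atTop (𝓝 (4 * 0)) :=
      (tendsto_pow_atTop_nhds_zero_of_lt_one (by norm_num) (by norm_num)).const_mul 4
    rw [mul_zero] at hp
    have hn := tendsto_natCast_atTop_atTop (R := ℝ)
    obtain ⟨k, h1, h2, h3, h4⟩ := ((hp.eventually (ge_mem_nhds hδ)).and
      ((hn.eventually_ge_atTop ‖ξ‖).and ((hn.eventually_ge_atTop ‖Q‖).and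
        (hn.eventually_ge_atTop M)))).exists
    exact ⟨k, ⟨ξ, Q, h2, h3, fun v hv => h v (hv.trans h1)⟩,
      fun v hv => (hM v hv).trans (by gcongr)⟩
  have hε2 : ε / 2 ≠ 0 := by simpa using hε
  obtain ⟨φ, hφ, K, hK, hμK, hKF⟩ := exists_isClosed_forall_mem_of_ae μ hF hmono hae hε2
  set S : Set E := {x | ∃ (ξ : E →L[ℝ] ℝ) (Q : E →L[ℝ] E →L[ℝ] ℝ), ∀ ε > 0, ∃ δ > 0, ∀ h,
    ‖h‖ ≤ δ → |taylorRem u x ξ Q h| ≤ ε * ‖h‖ ^ 2} with hS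
  have hS0 : μ (Sᶜ ∪ {0}) = 0 := measure_union_null hA (measure_singleton 0)
  obtain ⟨O, hO, hOopen, hμO⟩ := (Sᶜ ∪ {0}).exists_isOpen_lt_of_lt (μ := μ) (ε / 2)
    (by rw [hS0]; exact pos_iff_ne_zero.2 hε2)
  have hKS : ∀ x ∈ K ∩ Oᶜ, x ∈ S := by
    intro x hx
    by_contra hc
    exact hx.2 (hO (Or.inl hc))
  set J : ℕ → ℕ := fun k => Nat.findGreatest (fun j => φ j ≤ k) k with hJ
  have hJle : ∀ k, J k ≠ 0 → φ (J k) ≤ k := fun k h =>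
    Nat.findGreatest_of_ne_zero (P := fun j => φ j ≤ k) rfl h
  have hleJ : ∀ j k, φ j ≤ k → j ≤ J k := fun j k h =>
    Nat.le_findGreatest ((hφ.id_le j).trans h) h
  have hJmono : Monotone J := by
    intro k l hkl
    by_cases h0 : J k = 0
    · rw [h0]; exact Nat.zero_le _
    · exact hleJ _ _ ((hJle k h0).trans hkl)
  classical
  choose! ξ Q hT using fun x (hx : x ∈ S) => hx
  refine ⟨K ∩ Oᶜ, hK.inter hOopen.isClosed_compl, ?_, fun h => h.2 (hO (Or.inr rfl)), J,
    fun m => (φ m : ℝ) + 1, ξ, Q, ?_, hJmono, ?_, fun m => by positivity, ?_⟩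
  · rw [compl_inter, compl_compl]
    calc _ ≤ μ Kᶜ + μ O := measure_union_le _ _
      _ < ε / 2 + ε / 2 := ENNReal.add_lt_add hμK hμO
      _ = ε := ENNReal.add_halves ε
  · exact tendsto_atTop_mono' atTop (f₁ := J) (Eventually.of_forall fun k => le_rfl)
      (tendsto_atTop_atTop_of_monotone hJmono fun j => ⟨φ j, hleJ j _ le_rfl⟩)
  · intro k
    by_cases h0 : J (k + 1) = 0
    · rw [h0]; exact Nat.zero_le _
    · have h1 := hJle _ h0
      obtain ⟨j, hj⟩ := Nat.exists_eq_add_one_of_ne_zero h0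
      rw [hj] at h1 ⊢
      have h2 : φ j < φ (j + 1) := hφ (Nat.lt_succ_self j)
      have := hleJ j k (by omega)
      omega
  · intro x hx
    have hTx := hT x (hKS x hx)
    refine ⟨?_, ?_, ?_⟩
    · intro m hm h
      obtain ⟨⟨ξ', Q', -, hQ', h'⟩, -⟩ := hKF x hx.1 m hm
      have h1 := (eq_of_taylorRem_le hTx (by positivity) h' h).2
      have h2 := Q'.le_opNorm₂ h h
      rw [Real.norm_eq_abs] at h2
      have h3 : e m ≤ 1 / 2 := by
        simp only [he]
        have : (1 / ((m : ℝ) + 1)) ^ 3 ≤ 1 :=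
          pow_le_one₀ (by positivity)
            (by rw [div_le_one (by positivity)]; linarith [m.cast_nonneg (α := ℝ)])
        linarith
      have h4 : ‖Q'‖ * ‖h‖ * ‖h‖ ≤ φ m * ‖h‖ ^ 2 := by
        rw [mul_assoc, ← sq]; gcongr
      have h5 : e m * ‖h‖ ^ 2 ≤ 1 / 2 * ‖h‖ ^ 2 := by gcongr
      rw [abs_le] at h1 h2 ⊢
      constructor <;> nlinarith
    · intro m hm h hh
      exact ((hKF x hx.1 m hm).2 h hh).trans (by gcongr; linarith)
    · intro k hk h hh
      have hJ0 : J k ≠ 0 := by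
        intro h0
        rw [h0, Nat.cast_zero] at hk
        exact absurd hk (norm_nonneg x).not_gt
      obtain ⟨⟨ξ', Q', -, -, h'⟩, -⟩ := hKF x hx.1 (J k) hk
      obtain ⟨h1, h2⟩ := eq_of_taylorRem_le hTx (by positivity) h' h
      have hh2 : ‖h‖ ≤ 4 * (1 / 2 : ℝ) ^ φ (J k) := hh.trans (mul_le_mul_of_nonneg_left
        (pow_le_pow_of_le_one (by norm_num) (by norm_num) (hJle k hJ0)) (by norm_num))
      have h3 := h' h hh2
      have : taylorRem u x (ξ x) (Q x) h =
          taylorRem u x ξ' Q' h + 1 / 2 * (Q' h h - Q x h h) := by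
        simp only [taylorRem, h1]; ring
      rw [this]
      refine (abs_add_le _ _).trans ((add_le_add h3 h2).trans (le_of_eq ?_))
      simp only [he]; ring

end Taylor

section Mollify

open ContinuousLinearMap Convolution

variable {E : Type*} [NormedAddCommGroup E] [InnerProductSpace ℝ E] [FiniteDimensional ℝ E]
  [MeasurableSpace E] [BorelSpace E] (μ : Measure E) [μ.IsAddHaarMeasure]

/-- A smooth even probability density supported in the unit ball. -/
noncomputable def mollifier : E → ℝ :=
  (⟨1 / 2, 1, by norm_num, by norm_num⟩ : ContDiffBump (0 : E)).normed μ

theorem mollifier_nonneg (z : E) : 0 ≤ mollifier μ z := ContDiffBump.nonneg_normed _ _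

theorem mollifier_neg (z : E) : mollifier μ (-z) = mollifier μ z := ContDiffBump.normed_neg _ _

theorem contDiff_mollifier {n : ℕ∞} : ContDiff ℝ n (mollifier μ) := ContDiffBump.contDiff_normed _

theorem continuous_mollifier : Continuous (mollifier μ) := ContDiffBump.continuous_normed _

theorem integral_mollifier : ∫ z, mollifier μ z ∂μ = 1 := ContDiffBump.integral_normed _

theorem mollifier_eq_zero {z : E} (hz : 1 ≤ ‖z‖) : mollifier μ z = 0 := by
  rw [← Function.notMem_support, mollifier, ContDiffBump.support_normed_eq, mem_ball_zero_iff]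
  exact hz.not_gt

theorem hasCompactSupport_mollifier : HasCompactSupport (mollifier μ) :=
  ContDiffBump.hasCompactSupport_normed _

theorem integrable_mollifier_mul {g : E → ℝ} (hg : Continuous g) :
    Integrable (fun z => mollifier μ z * g z) μ :=
  ((continuous_mollifier μ).mul hg).integrable_of_hasCompactSupport
    (hasCompactSupport_mollifier μ).mul_right

/-- The average of `g` around `p.2` at scale `p.1`. -/
noncomputable def mollify (g : E → ℝ) (p : ℝ × E) : ℝ :=
  ∫ z, mollifier μ z * g (p.2 - p.1 • z) ∂μ

/-- The convolution kernel of `mollify` at scale `s`. -/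
noncomputable def mollifyKernel (s : ℝ) (x : E) : ℝ :=
  (s ^ Module.finrank ℝ E)⁻¹ * mollifier μ (s⁻¹ • x)

theorem mollify_eq_convolution (g : E → ℝ) {s : ℝ} (hs : 0 < s) (y : E) :
    mollify μ g (s, y) = (g ⋆[mul ℝ ℝ, μ] mollifyKernel μ s) y := by
  rw [convolution_eq_swap]
  have h := Measure.integral_comp_smul_of_nonneg μ
    (fun t => mollifier μ (s⁻¹ • t) * g (y - t)) s (hR := hs.le)
  simp only [smul_smul, inv_mul_cancel₀ hs.ne', one_smul, smul_eq_mul] at h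
  rw [mollify, h, ← integral_const_mul]
  refine integral_congr_ae (Eventually.of_forall fun t => ?_)
  simp only [mul_apply', mollifyKernel]
  ring

theorem contDiffOn_mollifyKernel {n : ℕ∞} :
    ContDiffOn ℝ n ↿(mollifyKernel (E := E) μ) (Ioo (1 / 2) 2 ×ˢ univ) := by
  have h1 : ContDiffOn ℝ n (fun p : ℝ × E => p.1⁻¹) (Ioo (1 / 2) 2 ×ˢ univ) :=
    contDiffOn_fst.inv fun p hp => by
      have := hp.1.1
      linarith
  have h2 : ContDiffOn ℝ n (fun p : ℝ × E => (p.1 ^ Module.finrank ℝ E)⁻¹)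
      (Ioo (1 / 2) 2 ×ˢ univ) := by
    simp only [← inv_pow]
    exact h1.pow _
  exact h2.mul ((contDiff_mollifier μ).comp_contDiffOn (h1.smul contDiffOn_snd))

theorem mollifyKernel_eq_zero {s : ℝ} {x : E} (hs : s ∈ Ioo (1 / 2 : ℝ) 2)
    (hx : x ∉ closedBall (0 : E) 2) : mollifyKernel μ s x = 0 := by
  rw [mem_closedBall_zero_iff, not_le] at hx
  have hs0 : 0 < s := by linarith [hs.1]
  rw [mollifyKernel, mollifier_eq_zero, mul_zero]
  rw [norm_smul, norm_inv, Real.norm_of_nonneg hs0.le, inv_mul_eq_div, le_div_iff₀ hs0]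
  linarith [hs.2]

variable {V W : Type*} [NormedAddCommGroup V] [NormedSpace ℝ V] [NormedAddCommGroup W]
  [NormedSpace ℝ W]

theorem norm_convolution_le_of_support (L : ℝ →L[ℝ] V →L[ℝ] W) {g : E → ℝ} {κ : E → V}
    (hκ : Continuous κ) (hκ0 : ∀ x, x ∉ closedBall (0 : E) 2 → κ x = 0) {y : E} {G : ℝ}
    (hG : ∀ x ∈ closedBall y 2, |g x| ≤ G) :
    ‖(g ⋆[L, μ] κ) y‖ ≤ ‖L‖ * (∫ x, ‖κ x‖ ∂μ) * G := by
  have hint : Integrable (fun x => ‖κ x‖) μ :=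
    hκ.norm.integrable_of_hasCompactSupport
      (HasCompactSupport.intro (isCompact_closedBall (0 : E) 2) fun x hx => by
        rw [hκ0 x hx, norm_zero])
  rw [convolution_eq_swap]
  calc _ ≤ ∫ t, ‖L‖ * G * ‖κ t‖ ∂μ := by
        refine norm_integral_le_of_norm_le (hint.const_mul _) (Eventually.of_forall fun t => ?_)
        by_cases ht : t ∈ closedBall (0 : E) 2
        · have h1 : |g (y - t)| ≤ G := hG _ (by
            rw [mem_closedBall_zero_iff] at ht
            simpa [mem_closedBall, dist_eq_norm] using ht)
          refine (L.le_opNorm₂ _ _).trans ?_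
          rw [Real.norm_eq_abs]
          gcongr
        · rw [hκ0 t ht]; simp
    _ = _ := by rw [integral_const_mul]; ring

theorem ContinuousOn.continuous_of_prod_univ {X Y Z : Type*} [TopologicalSpace X]
    [TopologicalSpace Y] [TopologicalSpace Z] {f : X → Y → Z} {s : Set X} {x : X}
    (hf : ContinuousOn ↿f (s ×ˢ univ)) (hx : x ∈ s) : Continuous (f x) :=
  hf.comp_continuous (.prodMk_right _) fun _ => ⟨hx, mem_univ _⟩

variable (E) in
theorem exists_norm_iteratedFDeriv_mollify_le_at_one :
    ∃ C : ℝ, 0 ≤ C ∧ ∀ g : E → ℝ, Continuous g → ∀ y, ContDiffAt ℝ 2 (mollify μ g) (1, y) ∧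
      ∀ G, (∀ x ∈ closedBall y 2, |g x| ≤ G) → ∀ i ≤ 2,
        ‖iteratedFDeriv ℝ i (mollify μ g) (1, y)‖ ≤ C * G := by
  set s : Set ℝ := Ioo (1 / 2) 2
  have hs : IsOpen s := isOpen_Ioo
  have h1s : (1 : ℝ) ∈ s := by constructor <;> norm_num
  have hk := isCompact_closedBall (0 : E) 2
  have hsu : IsOpen (s ×ˢ (univ : Set E)) := hs.prod isOpen_univ
  set κ := mollifyKernel (E := E) μ
  have hκ : ContDiffOn ℝ 3 ↿κ (s ×ˢ univ) := contDiffOn_mollifyKernel μ (n := 3)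
  have hκ0 : ∀ p x, p ∈ s → x ∉ closedBall (0 : E) 2 → κ p x = 0 :=
    fun p x hp hx => mollifyKernel_eq_zero μ hp hx
  set κ' : ℝ → E → (ℝ × E →L[ℝ] ℝ) := fun p x => fderiv ℝ ↿κ (p, x)
  have hκ' : ContDiffOn ℝ 2 ↿κ' (s ×ˢ univ) := hκ.fderiv_of_isOpen hsu (by norm_num)
  set κ'' : ℝ → E → (ℝ × E →L[ℝ] (ℝ × E →L[ℝ] ℝ)) := fun p x => fderiv ℝ ↿κ' (p, x)
  have hκ'' : ContDiffOn ℝ 1 ↿κ'' (s ×ˢ univ) := hκ'.fderiv_of_isOpen hsu (by norm_num)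
  have hnhds : ∀ p x, p ∈ s → x ∉ closedBall (0 : E) 2 →
      s ×ˢ (closedBall (0 : E) 2)ᶜ ∈ 𝓝 (p, x) := fun p x hp hx =>
    (hs.prod isClosed_closedBall.isOpen_compl).mem_nhds ⟨hp, hx⟩
  have hκ'0 : ∀ p x, p ∈ s → x ∉ closedBall (0 : E) 2 → κ' p x = 0 := by
    intro p x hp hx
    have : ↿κ =ᶠ[𝓝 (p, x)] fun _ => 0 := by
      filter_upwards [hnhds p x hp hx] with q hq using hκ0 _ _ hq.1 hq.2
    simp only [κ']
    rw [this.fderiv_eq, fderiv_fun_const, Pi.zero_apply]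
  have hκ''0 : ∀ p x, p ∈ s → x ∉ closedBall (0 : E) 2 → κ'' p x = 0 := by
    intro p x hp hx
    have : ↿κ' =ᶠ[𝓝 (p, x)] fun _ => 0 := by
      filter_upwards [hnhds p x hp hx] with q hq using hκ'0 _ _ hq.1 hq.2
    simp only [κ'']
    rw [this.fderiv_eq, fderiv_fun_const, Pi.zero_apply]
  set L := ContinuousLinearMap.mul ℝ ℝ
  set L' := L.precompR (ℝ × E)
  set L'' := L'.precompR (ℝ × E)
  set C₀ := ‖L‖ * ∫ x, ‖κ 1 x‖ ∂μ
  set C₁ := ‖L'‖ * ∫ x, ‖κ' 1 x‖ ∂μ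
  set C₂ := ‖L''‖ * ∫ x, ‖κ'' 1 x‖ ∂μ
  have hC₀ : 0 ≤ C₀ := by positivity
  have hC₁ : 0 ≤ C₁ := by positivity
  have hC₂ : 0 ≤ C₂ := by positivity
  refine ⟨C₀ + C₁ + C₂, by positivity, fun g hg y => ?_⟩
  have hloc : LocallyIntegrable g μ := hg.locallyIntegrable
  have heq : EqOn (mollify μ g) (fun q => (g ⋆[L, μ] κ q.1) q.2) (s ×ˢ univ) := fun q hq =>
    mollify_eq_convolution μ g (by linarith [hq.1.1]) _
  have hmem : ((1 : ℝ), y) ∈ s ×ˢ (univ : Set E) := ⟨h1s, mem_univ _⟩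
  have hev := heq.eventuallyEq_of_mem (hsu.mem_nhds hmem)
  have hderiv : EqOn (fderiv ℝ (mollify μ g)) (fun q => (g ⋆[L', μ] κ' q.1) q.2)
      (s ×ˢ univ) := by
    intro q hq
    rw [(heq.eventuallyEq_of_mem (hsu.mem_nhds hq)).fderiv_eq]
    exact (hasFDerivAt_convolution_right_with_param L hs hk hκ0 hloc (hκ.of_le (by norm_num)) q
      hq.1).fderiv
  have hderiv2 : fderiv ℝ (fderiv ℝ (mollify μ g)) (1, y) = (g ⋆[L'', μ] κ'' 1) y := by
    rw [(hderiv.eventuallyEq_of_mem (hsu.mem_nhds hmem)).fderiv_eq]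
    exact (hasFDerivAt_convolution_right_with_param L' hs hk hκ'0 hloc
      (hκ'.of_le (by norm_num)) (1, y) h1s).fderiv
  constructor
  · have := contDiffOn_convolution_right_with_param (n := 2) L hs hk hκ0 hloc
      (hκ.of_le (by norm_num))
    exact (this.contDiffAt (hsu.mem_nhds hmem)).congr_of_eventuallyEq hev
  · intro G hG i hi
    have hG0 : 0 ≤ G := (abs_nonneg _).trans (hG y (mem_closedBall_self (by norm_num)))
    interval_cases i
    · rw [norm_iteratedFDeriv_zero, heq hmem]
      refine (norm_convolution_le_of_support μ L (hκ.continuousOn.continuous_of_prod_univ h1s)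
        (fun x hx => hκ0 1 x h1s hx) hG).trans ?_
      gcongr
      change C₀ ≤ _
      linarith
    · rw [norm_iteratedFDeriv_one, hderiv hmem]
      refine (norm_convolution_le_of_support μ L' (hκ'.continuousOn.continuous_of_prod_univ h1s)
        (fun x hx => hκ'0 1 x h1s hx) hG).trans ?_
      gcongr
      change C₁ ≤ _
      linarith
    · rw [← norm_iteratedFDeriv_fderiv, norm_iteratedFDeriv_one, hderiv2]
      refine (norm_convolution_le_of_support μ L'' (hκ''.continuousOn.continuous_of_prod_univ h1s)
        (fun x hx => hκ''0 1 x h1s hx) hG).trans ?_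
      gcongr
      change C₂ ≤ _
      linarith

end Mollify

section Mollify

variable {E : Type*} [NormedAddCommGroup E] [InnerProductSpace ℝ E] [FiniteDimensional ℝ E]
  [MeasurableSpace E] [BorelSpace E] (μ : Measure E) [μ.IsAddHaarMeasure]

theorem mollify_scale (g : E → ℝ) {s₀ : ℝ} (hs₀ : s₀ ≠ 0) (p : ℝ × E) :
    mollify μ g p = mollify μ (fun x => g (s₀ • x)) (s₀⁻¹ • p) := by
  simp only [mollify, Prod.smul_fst, Prod.smul_snd, smul_sub, smul_smul, smul_eq_mul,
    mul_inv_cancel_left₀ hs₀, mul_inv_cancel₀ hs₀, one_smul]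

theorem contDiffAt_mollify {g : E → ℝ} (hg : Continuous g) {p : ℝ × E} (hp : 0 < p.1) :
    ContDiffAt ℝ 2 (mollify μ g) p := by
  obtain ⟨C, -, h⟩ := exists_norm_iteratedFDeriv_mollify_le_at_one E μ
  have h1 := (h (fun x => g (p.1 • x)) (by fun_prop) (p.1⁻¹ • p.2)).1
  have e : mollify μ g = mollify μ (fun x => g (p.1 • x)) ∘ fun q => p.1⁻¹ • q :=
    funext fun q => mollify_scale μ g hp.ne' q
  rw [e]
  refine ContDiffAt.comp p ?_ (by fun_prop)
  convert h1 using 1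
  ext1
  · simp [hp.ne']
  · simp

variable (E) in
/-- Derivative bounds for averages at a variable scale. -/
theorem exists_norm_iteratedFDeriv_mollify_comp_le {B : ℝ} (hB : 0 ≤ B) :
    ∃ C : ℝ, 0 ≤ C ∧ ∀ g : E → ℝ, Continuous g → ∀ r : E → ℝ, ContDiff ℝ 2 r →
      (∀ y, 0 < r y) → ∀ y, ‖iteratedFDeriv ℝ 1 r y‖ ≤ B → r y * ‖iteratedFDeriv ℝ 2 r y‖ ≤ B →
      ∀ G, (∀ x ∈ closedBall y (2 * r y), |g x| ≤ G) → ∀ i ≤ 2,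
        ‖iteratedFDeriv ℝ i (fun x => mollify μ g (r x, x)) y‖ ≤ C * G / r y ^ i := by
  obtain ⟨C, hC, h⟩ := exists_norm_iteratedFDeriv_mollify_le_at_one E μ
  refine ⟨2 * C * (B + 1) ^ 2, by positivity, fun g hg r hr hr0 y h1 h2 G hG i hi => ?_⟩
  set s := r y with hs
  have hs0 : 0 < s := hr0 y
  have hG0 : 0 ≤ G := (abs_nonneg _).trans (hG y (mem_closedBall_self (by positivity)))
  set g' : E → ℝ := fun x => g (s • x) with hg'
  have hg'c : Continuous g' := by fun_prop
  obtain ⟨-, hbd⟩ := h g' hg'c (s⁻¹ • y)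
  have hbd := hbd G (fun x hx => hG _ (by
    rw [mem_closedBall, dist_eq_norm] at hx ⊢
    have e : s • x - y = s • (x - s⁻¹ • y) := by
      rw [smul_sub, smul_smul, mul_inv_cancel₀ hs0.ne', one_smul]
    rw [e, norm_smul, Real.norm_of_nonneg hs0.le]
    nlinarith))
  set ψ : E → ℝ × E := fun x => (s⁻¹ • r x, s⁻¹ • x) with hψ
  have hψy : ψ y = (1, s⁻¹ • y) := by simp [hψ, ← hs, hs0.ne']
  have hψc : ContDiff ℝ 2 ψ := (hr.const_smul _).prodMk (by fun_prop)
  have e : (fun x => mollify μ g (r x, x)) = mollify μ g' ∘ ψ :=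
    funext fun x => mollify_scale μ g hs0.ne' _
  have hopen : IsOpen {p : ℝ × E | 0 < p.1} := isOpen_lt continuous_const continuous_fst
  have hon : ContDiffOn ℝ 2 (mollify μ g') {p : ℝ × E | 0 < p.1} := fun p hp =>
    (contDiffAt_mollify μ hg'c hp).contDiffWithinAt
  have hmem : ∀ x, ψ x ∈ {p : ℝ × E | 0 < p.1} := fun x => by
    have := hr0 x
    simp only [hψ, mem_ofPred_eq, smul_eq_mul]
    positivity
  have hD : ∀ j, 1 ≤ j → j ≤ i → ‖iteratedFDerivWithin ℝ j ψ univ y‖ ≤ ((B + 1) / s) ^ j := by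
    intro j hj1 hji
    have hj2 : j ≤ 2 := hji.trans hi
    rw [iteratedFDerivWithin_univ, hψ, iteratedFDeriv_prodMk (n := 2)
      (hr.const_smul _).contDiffAt (by fun_prop) (by exact_mod_cast hj2),
      ContinuousMultilinearMap.opNorm_prod, max_le_iff,
      iteratedFDeriv_const_smul_apply' (hr.contDiffAt.of_le (by exact_mod_cast hj2)), norm_smul,
      norm_inv, Real.norm_of_nonneg hs0.le]
    interval_cases j
    · constructor
      · rw [pow_one, inv_mul_eq_div]; gcongr; linarith
      · rw [norm_iteratedFDeriv_one, pow_one]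
        have : HasFDerivAt (fun x : E => s⁻¹ • x) (s⁻¹ • ContinuousLinearMap.id ℝ E) y :=
          (hasFDerivAt_id y).const_smul _
        rw [this.fderiv, norm_smul, norm_inv, Real.norm_of_nonneg hs0.le, inv_mul_eq_div]
        gcongr
        exact ContinuousLinearMap.norm_id_le.trans (by linarith)
    · constructor
      · rw [div_pow, inv_mul_eq_div, div_le_div_iff₀ hs0 (by positivity)]
        have : s * (s * ‖iteratedFDeriv ℝ 2 r y‖) ≤ s * (B + 1) ^ 2 := by
          gcongr; nlinarith
        linarith
      · rw [← norm_iteratedFDeriv_fderiv]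
        have : fderiv ℝ (fun x : E => s⁻¹ • x) = fun _ => s⁻¹ • ContinuousLinearMap.id ℝ E :=
          funext fun x => ((hasFDerivAt_id x).const_smul s⁻¹).fderiv
        rw [this, norm_iteratedFDeriv_one, fderiv_fun_const, Pi.zero_apply, norm_zero]
        positivity
  have key := norm_iteratedFDerivWithin_comp_le (N := 2) (n := i) hon hψc.contDiffOn
    (by exact_mod_cast hi) hopen.uniqueDiffOn uniqueDiffOn_univ (fun x _ => hmem x)
    (mem_univ y) (C := C * G) (D := (B + 1) / s) (by
      intro j hj
      rw [iteratedFDerivWithin_of_isOpen j hopen (hmem y), hψy]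
      exact hbd j (hj.trans hi)) hD
  rw [iteratedFDerivWithin_univ, ← e] at key
  refine key.trans ?_
  rw [div_pow, mul_div_assoc']
  have hf : (i.factorial : ℝ) ≤ 2 := by interval_cases i <;> norm_num
  have hp : (B + 1) ^ i ≤ (B + 1) ^ 2 := pow_le_pow_right₀ (by linarith) hi
  refine div_le_div_of_nonneg_right ?_ (by positivity)
  calc (i.factorial : ℝ) * (C * G) * (B + 1) ^ i ≤ 2 * (C * G) * (B + 1) ^ 2 := by gcongr
    _ = _ := by ring

theorem contDiff_mollify_comp {g : E → ℝ} (hg : Continuous g) {r : E → ℝ} (hr : ContDiff ℝ 2 r)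
    (hr0 : ∀ y, 0 < r y) : ContDiff ℝ 2 fun x => mollify μ g (r x, x) :=
  contDiff_iff_contDiffAt.2 fun x =>
    ContDiffAt.comp (g := mollify μ g) (f := fun x => (r x, x)) x (contDiffAt_mollify μ hg (hr0 x))
      (hr.prodMk contDiff_id).contDiffAt

theorem continuous_mollify {g : E → ℝ} (hg : Continuous g) : Continuous (mollify μ g) := by
  have h := continuous_parametric_integral_of_continuous (μ := μ)
    (f := fun (p : ℝ × E) z => mollifier μ z * g (p.2 - p.1 • z))
    (by have := continuous_mollifier μ
        simp only [Function.uncurry_def]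
        fun_prop)
    (isCompact_closedBall (0 : E) 1)
  convert h using 2 with p
  rw [mollify, setIntegral_eq_integral_of_forall_compl_eq_zero]
  intro z hz
  rw [mem_closedBall_zero_iff, not_le] at hz
  rw [mollifier_eq_zero μ hz.le, zero_mul]

theorem mollify_zero_left (g : E → ℝ) (y : E) : mollify μ g (0, y) = g y := by
  simp [mollify, integral_mul_const, integral_mollifier]

theorem mollify_sub {g₁ g₂ : E → ℝ} (h₁ : Continuous g₁) (h₂ : Continuous g₂) (p : ℝ × E) :
    mollify μ (fun x => g₁ x - g₂ x) p = mollify μ g₁ p - mollify μ g₂ p := by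
  simp only [mollify, mul_sub]
  exact integral_sub (integrable_mollifier_mul μ (by fun_prop))
    (integrable_mollifier_mul μ (by fun_prop))

theorem mollify_sub_self {g : E → ℝ} (hg : Continuous g) (s : ℝ) (y : E) :
    mollify μ g (s, y) - g y =
      1 / 2 * ∫ z, mollifier μ z * (g (y + s • z) + g (y - s • z) - 2 * g y) ∂μ := by
  have h1 : mollify μ g (s, y) = ∫ z, mollifier μ z * g (y + s • z) ∂μ := by
    rw [mollify, ← integral_neg_eq_self]
    simp [mollifier_neg]
  have h2 : ∫ z, mollifier μ z * (2 * g y) ∂μ = 2 * g y := by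
    rw [integral_mul_const, integral_mollifier, one_mul]
  have i1 := integrable_mollifier_mul μ (g := fun z => g (y + s • z)) (by fun_prop)
  have i2 := integrable_mollifier_mul μ (g := fun z => g (y - s • z)) (by fun_prop)
  have i3 := integrable_mollifier_mul μ (g := fun _ => 2 * g y) (by fun_prop)
  simp only [mul_sub, mul_add]
  have e1 := integral_sub (i1.add i2) i3
  have e2 := integral_add i1 i2
  simp only [Pi.add_apply] at e1
  rw [e1, e2, h2, ← h1]
  simp only [mollify]
  ring

theorem mollify_sub_self_le {g : E → ℝ} (hg : Continuous g) {s : ℝ} {y : E} {D : ℝ}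
    (hD : ∀ z, ‖z‖ ≤ 1 → g (y + s • z) + g (y - s • z) - 2 * g y ≤ D) :
    mollify μ g (s, y) - g y ≤ 1 / 2 * D := by
  rw [mollify_sub_self μ hg]
  gcongr
  calc _ ≤ ∫ z, mollifier μ z * D ∂μ := by
        refine integral_mono (integrable_mollifier_mul μ (by fun_prop))
          (integrable_mollifier_mul μ continuous_const) fun z => ?_
        rcases le_total ‖z‖ 1 with hz | hz
        · exact mul_le_mul_of_nonneg_left (hD z hz) (mollifier_nonneg μ z)
        · simp [mollifier_eq_zero μ hz]
    _ = D := by rw [integral_mul_const, integral_mollifier, one_mul]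

/-- The second-order polynomial centered at `x₀` with the given coefficients. -/
noncomputable def quadPoly (a : ℝ) (ξ : E →L[ℝ] ℝ) (Q : E →L[ℝ] E →L[ℝ] ℝ) (x₀ x : E) : ℝ :=
  a + ξ (x - x₀) + 1 / 2 * Q (x - x₀) (x - x₀)

theorem contDiff_quadPoly (a : ℝ) (ξ : E →L[ℝ] ℝ) (Q : E →L[ℝ] E →L[ℝ] ℝ) (x₀ : E) :
    ContDiff ℝ 2 (quadPoly a ξ Q x₀) := by
  unfold quadPoly
  fun_prop

theorem mollify_quadPoly (a : ℝ) (ξ : E →L[ℝ] ℝ) (Q : E →L[ℝ] E →L[ℝ] ℝ) (x₀ : E) (s : ℝ)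
    (y : E) : mollify μ (quadPoly a ξ Q x₀) (s, y) =
      quadPoly a ξ Q x₀ y + 1 / 2 * (∫ z, mollifier μ z * Q z z ∂μ) * (s * s) := by
  have h := mollify_sub_self μ (contDiff_quadPoly a ξ Q x₀).continuous s y
  have e : ∀ z, mollifier μ z * (quadPoly a ξ Q x₀ (y + s • z) + quadPoly a ξ Q x₀ (y - s • z) -
      2 * quadPoly a ξ Q x₀ y) = mollifier μ z * Q z z * (s * s) := by
    intro z
    have e1 : y + s • z - x₀ = (y - x₀) + s • z := by abel
    have e2 : y - s • z - x₀ = (y - x₀) - s • z := by abel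
    simp only [quadPoly, e1, e2, map_add, map_sub, map_smul, FunLike.coe_add,
      FunLike.coe_sub, FunLike.coe_smul, Pi.add_apply, Pi.sub_apply, Pi.smul_apply, smul_eq_mul]
    ring
  simp only [e] at h
  rw [integral_mul_const] at h
  linarith

theorem abs_integral_mollifier_mul_le {Q : E →L[ℝ] E →L[ℝ] ℝ} {M : ℝ} (hM : 0 ≤ M)
    (hQ : ∀ h, |Q h h| ≤ M * ‖h‖ ^ 2) : |∫ z, mollifier μ z * Q z z ∂μ| ≤ M := by
  calc _ ≤ ∫ z, mollifier μ z * M ∂μ := by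
        rw [← Real.norm_eq_abs]
        refine norm_integral_le_of_norm_le (integrable_mollifier_mul μ continuous_const)
          (Eventually.of_forall fun z => ?_)
        rw [norm_mul, Real.norm_of_nonneg (mollifier_nonneg μ z), Real.norm_eq_abs]
        rcases le_total ‖z‖ 1 with hz | hz
        · refine mul_le_mul_of_nonneg_left ((hQ z).trans ?_) (mollifier_nonneg μ z)
          exact mul_le_of_le_one_right hM (pow_le_one₀ (norm_nonneg _) hz)
        · simp [mollifier_eq_zero μ hz]
    _ = M := by rw [integral_mul_const, integral_mollifier, one_mul]

variable (E) in
/-- Averages of a function close to a polynomial have second derivative close to that of the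
polynomial. -/
theorem exists_norm_iteratedFDeriv_mollify_sub_quadPoly_le :
    ∃ C : ℝ, 0 ≤ C ∧ ∀ u : E → ℝ, Continuous u → ∀ r : E → ℝ, ContDiff ℝ 2 r →
      (∀ y, 0 < r y) → ∀ (a : ℝ) (ξ : E →L[ℝ] ℝ) (Q : E →L[ℝ] E →L[ℝ] ℝ) (x₀ y : E) (b G M : ℝ),
      0 ≤ b → b ≤ 1 → 0 ≤ M → (∀ h, |Q h h| ≤ M * ‖h‖ ^ 2) →
      ‖iteratedFDeriv ℝ 1 r y‖ ≤ b → r y * ‖iteratedFDeriv ℝ 2 r y‖ ≤ b →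
      (∀ x ∈ closedBall y (2 * r y), |u x - quadPoly a ξ Q x₀ x| ≤ G) →
      ‖iteratedFDeriv ℝ 2 (fun x => mollify μ u (r x, x) - quadPoly a ξ Q x₀ x) y‖ ≤
        C * G / r y ^ 2 + 2 * M * b := by
  obtain ⟨C, hC, h⟩ := exists_norm_iteratedFDeriv_mollify_comp_le E μ zero_le_one
  refine ⟨C, hC, fun u hu r hr hr0 a ξ Q x₀ y b G M hb0 hb1 hM hQ h1 h2 hG => ?_⟩
  set p := quadPoly a ξ Q x₀ with hp
  have hpc : Continuous p := (contDiff_quadPoly a ξ Q x₀).continuous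
  set c := ∫ z, mollifier μ z * Q z z ∂μ with hc
  have hcM : |c| ≤ M := abs_integral_mollifier_mul_le μ hM hQ
  have hfc : ContDiff ℝ 2 fun x => mollify μ (fun x => u x - p x) (r x, x) :=
    contDiff_mollify_comp μ (hu.sub hpc) hr hr0
  have e : (fun x => mollify μ u (r x, x) - p x) =
      (fun x => mollify μ (fun x => u x - p x) (r x, x)) +
        (fun x => (1 / 2 * c) • (r x * r x)) := by
    funext x
    simp only [Pi.add_apply, smul_eq_mul]
    rw [mollify_sub μ hu hpc, hp, mollify_quadPoly]
    ring
  have hrr : ContDiff ℝ 2 fun x => r x * r x := hr.mul hr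
  rw [e, iteratedFDeriv_add_apply hfc.contDiffAt (hrr.const_smul _).contDiffAt]
  refine (norm_add_le _ _).trans (add_le_add ?_ ?_)
  · exact h _ (hu.sub hpc) r hr hr0 y (h1.trans hb1) (h2.trans hb1) G hG 2 le_rfl
  · rw [iteratedFDeriv_const_smul_apply' hrr.contDiffAt, norm_smul]
    have := norm_iteratedFDeriv_mul_le hr hr y (n := 2) le_rfl
    simp only [Finset.sum_range_succ, Finset.range_zero, Finset.sum_empty, norm_iteratedFDeriv_zero,
      Real.norm_of_nonneg (hr0 y).le] at this
    simp only [Nat.choose_zero_right, Nat.choose_self, Nat.choose_one_right, Nat.cast_one,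
      Nat.sub_zero, zero_add, one_mul, Nat.cast_ofNat, Nat.add_one_sub_one] at this
    have h0 : ‖iteratedFDeriv ℝ (2 - 2) r y‖ = r y :=
      norm_iteratedFDeriv_zero.trans (Real.norm_of_nonneg (hr0 y).le)
    rw [h0] at this
    have hb2 : ‖iteratedFDeriv ℝ 1 r y‖ * ‖iteratedFDeriv ℝ 1 r y‖ ≤ b * 1 := by
      gcongr; exact h1.trans hb1
    have h4 : ‖iteratedFDeriv ℝ 2 (fun x => r x * r x) y‖ ≤ 4 * b := by linarith
    rw [norm_mul, Real.norm_of_nonneg (by norm_num : (0 : ℝ) ≤ 1 / 2), Real.norm_eq_abs]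
    calc 1 / 2 * |c| * _ ≤ 1 / 2 * M * (4 * b) := by gcongr
      _ = _ := by ring

end Mollify

section Cutoff

variable (E : Type*) [NormedAddCommGroup E] [InnerProductSpace ℝ E] [FiniteDimensional ℝ E]
  [MeasurableSpace E] [BorelSpace E]

/-- `C²` cutoffs between two level sets of a 1-Lipschitz function. -/
theorem exists_contDiff_cutoff : ∃ C : ℝ, 0 ≤ C ∧ ∀ d : E → ℝ, LipschitzWith 1 d →
    ∀ t δ : ℝ, 0 < δ → ∃ f : E → ℝ, ContDiff ℝ 2 f ∧ (∀ y, 0 ≤ f y) ∧ (∀ y, f y ≤ 1) ∧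
      (∀ y, t ≤ d y → f y = 1) ∧ (∀ y, d y ≤ t - δ → f y = 0) ∧
      ∀ i ≤ 2, ∀ y, ‖iteratedFDeriv ℝ i f y‖ ≤ C / δ ^ i := by
  let μ : Measure E := volume
  obtain ⟨C, hC, h⟩ := exists_norm_iteratedFDeriv_mollify_comp_le E μ le_rfl
  refine ⟨16 * C, by positivity, fun d hd t δ hδ => ?_⟩
  set g : E → ℝ := fun x => max 0 (min 1 ((d x - (t - 3 / 4 * δ)) / (δ / 2))) with hg
  have hdc := hd.continuous
  have hgc : Continuous g := by fun_prop
  have hg0 : ∀ x, 0 ≤ g x := fun x => le_max_left _ _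
  have hg1 : ∀ x, g x ≤ 1 := fun x => max_le zero_le_one (min_le_left _ _)
  have hr : ContDiff ℝ 2 fun _ : E => δ / 4 := contDiff_const
  have hr0 : ∀ y : E, 0 < (fun _ : E => δ / 4) y := fun _ => by positivity
  have hdist : ∀ y z : E, ‖z‖ ≤ 1 → |d (y - (δ / 4) • z) - d y| ≤ δ / 4 := by
    intro y z hz
    have := hd.dist_le_mul (y - (δ / 4) • z) y
    rw [Real.dist_eq, dist_eq_norm, NNReal.coe_one, one_mul, sub_sub_cancel_left, norm_neg,
      norm_smul, Real.norm_of_nonneg (by positivity)] at this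
    exact this.trans (mul_le_of_le_one_right (by positivity) hz)
  have hconst : ∀ y c, (∀ z : E, ‖z‖ ≤ 1 → g (y - (δ / 4) • z) = c) →
      mollify μ g (δ / 4, y) = c := by
    intro y c hz
    calc mollify μ g (δ / 4, y) = ∫ z, mollifier μ z * c ∂μ := by
          refine integral_congr_ae (Eventually.of_forall fun z => ?_)
          rcases le_total ‖z‖ 1 with h1 | h1
          · simp only [hz z h1]
          · simp [mollifier_eq_zero μ h1]
      _ = c := by rw [integral_mul_const, integral_mollifier, one_mul]
  refine ⟨fun y => mollify μ g (δ / 4, y), contDiff_mollify_comp μ hgc hr hr0, fun y => ?_,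
    fun y => ?_, fun y hy => ?_, fun y hy => ?_, fun i hi y => ?_⟩
  · exact integral_nonneg fun z => mul_nonneg (mollifier_nonneg μ z) (hg0 _)
  · calc mollify μ g (δ / 4, y) ≤ ∫ z, mollifier μ z * 1 ∂μ := by
          refine integral_mono (integrable_mollifier_mul μ (by fun_prop))
            (integrable_mollifier_mul μ continuous_const) fun z => ?_
          exact mul_le_mul_of_nonneg_left (hg1 _) (mollifier_nonneg μ z)
      _ = 1 := by rw [integral_mul_const, integral_mollifier, one_mul]
  · refine hconst y 1 fun z hz => ?_
    have := abs_le.1 (hdist y z hz)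
    have h1 : 1 ≤ (d (y - (δ / 4) • z) - (t - 3 / 4 * δ)) / (δ / 2) := by
      rw [one_le_div (by positivity)]; linarith
    simp [hg, h1]
  · refine hconst y 0 fun z hz => ?_
    have := abs_le.1 (hdist y z hz)
    have h1 : (d (y - (δ / 4) • z) - (t - 3 / 4 * δ)) / (δ / 2) ≤ 0 :=
      div_nonpos_of_nonpos_of_nonneg (by linarith) (by positivity)
    simp [hg, h1]
  · have := h g hgc _ hr hr0 y (by rw [norm_iteratedFDeriv_one]; simp)
      (by rw [iteratedFDeriv_const_of_ne two_ne_zero]; simp) 1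
      (fun x _ => by rw [abs_of_nonneg (hg0 x)]; exact hg1 x) i hi
    refine this.trans ?_
    rw [div_pow, mul_one, div_div_eq_mul_div]
    refine div_le_div_of_nonneg_right ?_ (by positivity)
    have : (4 : ℝ) ^ i ≤ 4 ^ 2 := pow_le_pow_right₀ (by norm_num) hi
    nlinarith

/-- A `C²` function interpolating between the values `b k` on successive level sets of a
1-Lipschitz function, together with its truncations. -/
theorem exists_contDiff_staircase : ∃ C : ℝ, 0 ≤ C ∧ ∀ d : E → ℝ, LipschitzWith 1 d →
    ∀ t : ℕ → ℝ, StrictAnti t → (∀ y, d y ≤ t 0) → ∀ b : ℕ → ℝ, Antitone b → (∀ k, 0 ≤ b k) →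
    ∃ g : ℕ → E → ℝ, (∀ N, ContDiff ℝ 2 (g N)) ∧
      (∀ N y, ∃ k ≤ N, d y ≤ t k ∧ (k < N → t (k + 1) < d y) ∧ b (k + 1) ≤ g N y ∧ g N y ≤ b k ∧
        ∀ i ≤ 2, ‖iteratedFDeriv ℝ i (g N) y‖ ≤ C * b k / (t k - t (k + 1)) ^ i) ∧
      ∀ N M y, N ≤ M → t N < d y → g M =ᶠ[𝓝 y] g N := by
  obtain ⟨C, hC, h⟩ := exists_contDiff_cutoff E
  refine ⟨4 * C + 1, by positivity, fun d hd t ht hd0 b hb hb0 => ?_⟩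
  have hδ : ∀ k, 0 < (t k - t (k + 1)) / 2 := fun k => by
    have := ht k.lt_succ_self
    simp only [Nat.succ_eq_add_one] at this
    linarith
  choose f hf hf0 hf1 hft hftδ hfD using fun k => h d hd (t k) _ (hδ k)
  have hdc := hd.continuous
  have ev1 : ∀ k y, t k < d y → ∀ᶠ z in 𝓝 y, ∀ j ≥ k, f j z = 1 := fun k y hy => by
    filter_upwards [(isOpen_lt continuous_const hdc).mem_nhds hy] with z hz j hj
    exact hft j z ((ht.antitone hj).trans (le_of_lt hz))
  have ev0 : ∀ k y, d y ≤ t k → ∀ᶠ z in 𝓝 y, ∀ j < k, f j z = 0 := fun k y hy => by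
    rcases Nat.eq_zero_or_pos k with rfl | hk
    · simp
    obtain ⟨l, rfl⟩ := Nat.exists_eq_succ_of_ne_zero hk.ne'
    have hy' : d y < t l - (t l - t (l + 1)) / 2 := by
      have := hδ l; simp only [Nat.succ_eq_add_one] at hy; linarith
    filter_upwards [(isOpen_lt hdc continuous_const).mem_nhds hy'] with z hz j hj
    refine hftδ j z ((le_of_lt hz).trans ?_)
    rcases (Nat.lt_succ_iff.1 hj).eq_or_lt with rfl | hjl
    · exact le_rfl
    · have h1 := ht.antitone (show j + 1 ≤ l from hjl)
      have h2 := hδ l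
      have h3 := hδ j
      linarith
  set g : ℕ → E → ℝ := fun N y => b N + ∑ k ∈ Finset.range N, (b k - b (k + 1)) * f k y with hg
  have htel : ∀ N M, N ≤ M → ∀ y, (∀ j ≥ N, f j y = 1) → g M y = g N y := by
    intro N M hNM y hy
    induction M, hNM using Nat.le_induction with
    | base => rfl
    | succ M hM ih =>
      rw [← ih]
      simp only [hg, Finset.sum_range_succ, hy M hM]
      ring
  have hlow : ∀ k y, (∀ j < k, f j y = 0) → g k y = b k := by
    intro k y hy
    simp only [hg]
    rw [Finset.sum_eq_zero fun j hj => by rw [hy j (Finset.mem_range.1 hj), mul_zero], add_zero]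
  refine ⟨g, fun N => ?_, fun N y => ?_, fun N M y hNM hy => ?_⟩
  · refine contDiff_const.add (ContDiff.sum fun k _ => contDiff_const.mul (hf k))
  · by_cases hN : d y ≤ t N
    · have hev : g N =ᶠ[𝓝 y] fun _ => b N := (ev0 N y hN).mono fun z hz => hlow N z hz
      refine ⟨N, le_rfl, hN, fun hlt => absurd hlt (lt_irrefl _), ?_, hev.self_of_nhds.le, ?_⟩
      · rw [hev.self_of_nhds]; exact hb N.le_succ
      · intro i _
        have hδN : 0 < t N - t (N + 1) := by have := hδ N; linarith
        rw [(hev.iteratedFDeriv ℝ i).self_of_nhds]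
        rcases Nat.eq_zero_or_pos i with rfl | hi
        · rw [norm_iteratedFDeriv_zero, Real.norm_of_nonneg (hb0 N), pow_zero, div_one]
          have := hb0 N
          nlinarith [mul_nonneg hC this]
        · rw [iteratedFDeriv_const_of_ne hi.ne', Pi.zero_apply, norm_zero]
          have := hb0 N
          positivity
    · push Not at hN
      have hex : ∃ n, t n < d y := ⟨N, hN⟩
      classical
      obtain ⟨k, hk⟩ := Nat.exists_eq_succ_of_ne_zero (n := Nat.find hex) fun h0 => by
        have := Nat.find_spec hex
        rw [h0] at this
        exact absurd this (not_lt.2 (hd0 y))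
      have hk1 : t (k + 1) < d y := by have := Nat.find_spec hex; rwa [hk] at this
      have hk0 : d y ≤ t k := not_lt.1 (Nat.find_min hex (hk ▸ k.lt_succ_self))
      have hkN : k + 1 ≤ N := by
        have := Nat.find_min' hex hN
        omega
      have hev : g N =ᶠ[𝓝 y] (fun _ => b (k + 1)) + fun z => (b k - b (k + 1)) • f k z := by
        filter_upwards [ev1 _ y hk1, ev0 _ y hk0] with z h1 h0
        rw [htel _ _ hkN z h1]
        have := hlow k z h0
        simp only [hg, Finset.sum_range_succ, Pi.add_apply, smul_eq_mul] at this ⊢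
        linarith
      have hbk := hb k.le_succ
      simp only [Nat.succ_eq_add_one] at hbk
      have hb1 := hb0 (k + 1)
      have hval := hev.self_of_nhds
      simp only [Pi.add_apply, smul_eq_mul] at hval
      refine ⟨k, by omega, hk0, fun _ => hk1, ?_, ?_, ?_⟩
      · rw [hval]; nlinarith [hf0 k y]
      · rw [hval]; nlinarith [hf1 k y]
      · intro i hi
        have hδk : 0 < t k - t (k + 1) := by have := hδ k; linarith
        have hfi : ContDiffAt ℝ i (f k) y := ((hf k).of_le (by exact_mod_cast hi)).contDiffAt
        rw [(hev.iteratedFDeriv ℝ i).self_of_nhds,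
          iteratedFDeriv_add_apply contDiffAt_const (hfi.const_smul _)]
        rcases Nat.eq_zero_or_pos i with rfl | hi0
        · have hk2 := hf0 k y
          have hk3 := hf1 k y
          have : ‖iteratedFDeriv ℝ 0 (fun _ : E => b (k + 1)) y +
              iteratedFDeriv ℝ 0 (fun z => (b k - b (k + 1)) • f k z) y‖ ≤
              b (k + 1) + (b k - b (k + 1)) * 1 := by
            refine (norm_add_le _ _).trans (add_le_add ?_ ?_)
            · rw [norm_iteratedFDeriv_zero, Real.norm_of_nonneg hb1]
            · rw [norm_iteratedFDeriv_zero, norm_smul, Real.norm_of_nonneg (by linarith),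
                Real.norm_of_nonneg hk2]
              gcongr
          refine this.trans ?_
          have := hb0 k
          rw [pow_zero, div_one]
          nlinarith [mul_nonneg hC this]
        · rw [iteratedFDeriv_const_of_ne hi0.ne', Pi.zero_apply, zero_add,
            iteratedFDeriv_const_smul_apply' hfi, norm_smul, Real.norm_of_nonneg (by linarith)]
          have h1 := hfD k i hi y
          rw [div_pow, div_div_eq_mul_div] at h1
          have h2 : C * 2 ^ i ≤ 4 * C + 1 := by
            have : (2 : ℝ) ^ i ≤ 2 ^ 2 := pow_le_pow_right₀ (by norm_num) hi
            nlinarith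
          calc _ ≤ b k * ((4 * C + 1) / (t k - t (k + 1)) ^ i) := by
                refine mul_le_mul (by linarith) (h1.trans ?_) (norm_nonneg _) (hb0 k)
                exact div_le_div_of_nonneg_right h2 (by positivity)
            _ = _ := by ring
  · exact (ev1 N y hy).mono fun z hz => htel N M hNM z hz

/-- Smoothing radii that vanish on `K`, decay at infinity and vary slowly, with truncations. -/
theorem exists_contDiff_radii : ∃ C : ℝ, 0 ≤ C ∧ ∀ K : Set E, (∀ y, infDist y K ≤ 1) →
    ∀ κ c : ℕ → ℝ, Antitone κ → (∀ k, 0 < κ k) → Antitone c → (∀ m, 0 < c m) →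
    ∃ r : ℕ → E → ℝ, (∀ N, ContDiff ℝ 2 (r N)) ∧ (∀ N y, 0 < r N y) ∧
      (∀ (N : ℕ) y, ∃ m ≤ N, ∃ k ≤ N, (m : ℝ) ≤ ‖y‖ ∧ (m < N → ‖y‖ < m + 1) ∧
        infDist y K ≤ (1 / 2) ^ k ∧ (k < N → (1 / 2) ^ (k + 1) < infDist y K) ∧
        c (m + 1) * (κ (k + 1) * (1 / 2) ^ (k + 1)) ≤ r N y ∧ r N y ≤ c m * (κ k * (1 / 2) ^ k) ∧
        ‖iteratedFDeriv ℝ 1 (r N) y‖ ≤ C * (c m * κ k) ∧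
        ‖iteratedFDeriv ℝ 2 (r N) y‖ ≤ C * (c m * κ k) / (1 / 2) ^ k) ∧
      ∀ (N M : ℕ) y, N ≤ M → ‖y‖ < N → (1 / 2) ^ N < infDist y K → r M =ᶠ[𝓝 y] r N := by
  obtain ⟨C, hC, h⟩ := exists_contDiff_staircase E
  refine ⟨16 * C ^ 2, by positivity, fun K hK κ c hκ hκ0 hc hc0 => ?_⟩
  obtain ⟨g, hg, hgl, hgs⟩ := h (fun y => infDist y K) (lipschitz_infDist_pt K)
    (fun k => (1 / 2) ^ k) (pow_right_strictAnti₀ (by norm_num) (by norm_num)) (by simpa using hK)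
    (fun k => κ k * (1 / 2) ^ k)
    (fun i j hij => by
      have := hκ0 j
      have h1 := hκ hij
      have h2 : (1 / 2 : ℝ) ^ j ≤ (1 / 2) ^ i :=
        pow_le_pow_of_le_one (by norm_num) (by norm_num) hij
      exact mul_le_mul h1 h2 (by positivity) (this.le.trans h1))
    (fun k => by have := hκ0 k; positivity)
  obtain ⟨l, hl, hll, hls⟩ := h (fun y => -‖y‖) (lipschitzWith_one_norm.neg)
    (fun m => -m) (fun i j hij => by simpa using hij) (by simp) c hc (fun m => (hc0 m).le)
  have hlev : ∀ (N : ℕ) y, ∃ m ≤ N, ∃ k ≤ N, (m : ℝ) ≤ ‖y‖ ∧ (m < N → ‖y‖ < m + 1) ∧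
        infDist y K ≤ (1 / 2) ^ k ∧ (k < N → (1 / 2) ^ (k + 1) < infDist y K) ∧
        c (m + 1) * (κ (k + 1) * (1 / 2) ^ (k + 1)) ≤ l N y * g N y ∧
        l N y * g N y ≤ c m * (κ k * (1 / 2) ^ k) ∧
        ‖iteratedFDeriv ℝ 1 (fun x => l N x * g N x) y‖ ≤ 16 * C ^ 2 * (c m * κ k) ∧
        ‖iteratedFDeriv ℝ 2 (fun x => l N x * g N x) y‖ ≤
          16 * C ^ 2 * (c m * κ k) / (1 / 2) ^ k := by
    intro N y
    obtain ⟨m, hmN, hm1, hm2, hm3, hm4, hm5⟩ := hll N y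
    obtain ⟨k, hkN, hk1, hk2, hk3, hk4, hk5⟩ := hgl N y
    have hcm := hc0 m
    have hcm1 := hc0 (m + 1)
    have hκk := hκ0 k
    have hκk1 := hκ0 (k + 1)
    have hR : (0 : ℝ) < (1 / 2) ^ k := by positivity
    have hR1 : (1 / 2 : ℝ) ^ k ≤ 1 := pow_le_one₀ (by norm_num) (by norm_num)
    refine ⟨m, hmN, k, hkN, by linarith, fun h => ?_, hk1, hk2, ?_, ?_, ?_⟩
    · have := hm2 h
      push_cast at this
      linarith
    · exact mul_le_mul hm3 hk3 (by positivity) (hcm1.le.trans hm3)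
    · exact mul_le_mul hm4 hk4 (le_trans (by positivity) hk3) hcm.le
    have e : (1 / 2 : ℝ) ^ k - (1 / 2) ^ (k + 1) = (1 / 2) ^ k / 2 := by ring
    have el : -(m : ℝ) - -((m + 1 : ℕ) : ℝ) = 1 := by push_cast; ring
    simp only [el, one_pow, div_one] at hm5
    simp only [e] at hk5
    set R : ℝ := (1 / 2) ^ k with hRdef
    have L0 := hm5 0 (by norm_num)
    have L1 := hm5 1 (by norm_num)
    have L2 := hm5 2 (by norm_num)
    have G0 : ‖iteratedFDeriv ℝ 0 (g N) y‖ ≤ C * κ k * R := by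
      refine (hk5 0 (by norm_num)).trans_eq ?_; ring
    have G1 : ‖iteratedFDeriv ℝ 1 (g N) y‖ ≤ 2 * (C * κ k) := by
      refine (hk5 1 (by norm_num)).trans_eq ?_; field_simp
    have G2 : ‖iteratedFDeriv ℝ 2 (g N) y‖ ≤ 4 * (C * κ k) / R := by
      refine (hk5 2 (by norm_num)).trans_eq ?_; field_simp; norm_num
    constructor
    · refine (norm_iteratedFDeriv_mul_le (hl N) (hg N) y (n := 1) (by norm_num)).trans ?_
      simp only [Finset.sum_range_succ, Finset.range_zero, Finset.sum_empty, Nat.choose_zero_right,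
        Nat.choose_self, Nat.cast_one, Nat.sub_zero, zero_add, one_mul]
      calc _ ≤ (C * c m) * (2 * (C * κ k)) + (C * c m) * (C * κ k * R) := by gcongr
        _ ≤ (C * c m) * (2 * (C * κ k)) + (C * c m) * (C * κ k * 1) := by gcongr
        _ ≤ 16 * C ^ 2 * (c m * κ k) := by
          have : 0 ≤ C ^ 2 * (c m * κ k) := by positivity
          nlinarith
    · refine (norm_iteratedFDeriv_mul_le (hl N) (hg N) y (n := 2) le_rfl).trans ?_
      simp only [Finset.sum_range_succ, Finset.range_zero, Finset.sum_empty, Nat.choose_zero_right,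
        Nat.choose_self, Nat.choose_one_right, Nat.cast_one, Nat.cast_ofNat, Nat.sub_zero,
        Nat.add_one_sub_one, zero_add, one_mul]
      calc _ ≤ (C * c m) * (4 * (C * κ k) / R) + 2 * (C * c m) * (2 * (C * κ k)) +
              (C * c m) * (C * κ k * R) := by gcongr
        _ ≤ (C * c m) * (4 * (C * κ k) / R) + 2 * (C * c m) * (2 * (C * κ k) / R) +
              (C * c m) * (C * κ k / R) := by
            gcongr
            · exact le_div_self (by positivity) hR hR1
            · exact (mul_le_of_le_one_right (by positivity) hR1).trans
                (le_div_self (by positivity) hR hR1)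
        _ = 9 * (C ^ 2 * (c m * κ k)) / R := by ring
        _ ≤ 16 * C ^ 2 * (c m * κ k) / R := by
          refine div_le_div_of_nonneg_right ?_ hR.le
          have : 0 ≤ C ^ 2 * (c m * κ k) := by positivity
          nlinarith
  refine ⟨fun N y => l N y * g N y, fun N => (hl N).mul (hg N), fun N y => ?_, hlev, ?_⟩
  · obtain ⟨m, -, k, -, -, -, -, -, h1, -⟩ := hlev N y
    refine lt_of_lt_of_le ?_ h1
    have := hc0 (m + 1)
    have := hκ0 (k + 1)
    positivity
  · intro N M y hNM h1 h2
    exact (hls N M y hNM (by linarith)).mul (hgs N M y hNM h2)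

end Cutoff

section Limit

variable {E : Type*} [NormedAddCommGroup E] [NormedSpace ℝ E]

theorem exists_tendsto_hasFDerivAt {G : Type*} [NormedAddCommGroup G] [NormedSpace ℝ G]
    [CompleteSpace G] {f : ℕ → E → G} {f' : ℕ → E → E →L[ℝ] G}
    (hf : ∀ n y, HasFDerivAt (f n) (f' n y) y)
    (hf' : ∀ m : ℕ, UniformCauchySeqOn f' atTop (ball 0 m))
    (h0 : CauchySeq fun n => f n 0) :
    ∃ g : E → G, ∃ g' : E → E →L[ℝ] G, (∀ y, HasFDerivAt g (g' y) y) ∧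
      (∀ m : ℕ, UniformCauchySeqOn f atTop (ball 0 m)) ∧
      (∀ y, Tendsto (fun n => f n y) atTop (𝓝 (g y))) ∧
      (∀ y, Tendsto (fun n => f' n y) atTop (𝓝 (g' y))) ∧
      ((∀ n, Continuous (f' n)) → Continuous g') := by
  have hex : ∀ y : E, ∃ m : ℕ, y ∈ ball (0 : E) m := fun y => by
    simpa using exists_nat_gt ‖y‖
  have hfc : ∀ m : ℕ, UniformCauchySeqOn f atTop (ball 0 m) := fun m =>
    uniformCauchySeqOn_ball_of_fderiv (hf' m) (fun n y _ => hf n y) h0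
  have hl : ∀ y, ∃ a, Tendsto (fun n => f n y) atTop (𝓝 a) := fun y => by
    obtain ⟨m, hm⟩ := hex y
    exact cauchySeq_tendsto_of_complete ((hfc m).cauchySeq hm)
  have hl' : ∀ y, ∃ a, Tendsto (fun n => f' n y) atTop (𝓝 a) := fun y => by
    obtain ⟨m, hm⟩ := hex y
    exact cauchySeq_tendsto_of_complete ((hf' m).cauchySeq hm)
  choose g hg using hl
  choose g' hg' using hl'
  have hloc : ∀ m : ℕ, TendstoLocallyUniformlyOn f' g' atTop (ball 0 m) := fun m =>
    ((hf' m).tendstoUniformlyOn_of_tendsto fun y _ => hg' y).tendstoLocallyUniformlyOn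
  refine ⟨g, g', fun y => ?_, hfc, hg, hg', fun hc => continuous_iff_continuousAt.2 fun y => ?_⟩
  · obtain ⟨m, hm⟩ := hex y
    exact hasFDerivAt_of_tendstoLocallyUniformlyOn isOpen_ball (hloc m) (fun n y _ => hf n y)
      (fun y _ => hg y) hm
  · obtain ⟨m, hm⟩ := hex y
    exact ((hloc m).continuousOn (Frequently.of_forall fun n => (hc n).continuousOn)).continuousAt
      (isOpen_ball.mem_nhds hm)

/-- A sequence of `C²` functions which stabilizes near the origin and whose second derivatives are
uniformly Cauchy on balls has a `C²` limit. -/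
theorem exists_contDiff_two_tendsto {F : ℕ → E → ℝ} (hF : ∀ n, ContDiff ℝ 2 (F n)) {N₀ : ℕ}
    (h0 : ∀ n ≥ N₀, F n =ᶠ[𝓝 0] F N₀)
    (hC : ∀ m : ℕ, ∀ ε > 0, ∃ n, ∀ N ≥ n, ∀ y ∈ ball (0 : E) m,
      ‖iteratedFDeriv ℝ 2 (fun x => F N x - F n x) y‖ ≤ ε) :
    ∃ v : E → ℝ, ContDiff ℝ 2 v ∧ ∀ y, Tendsto (fun n => F n y) atTop (𝓝 (v y)) := by
  have hF1 : ∀ n, ContDiff ℝ 1 (fderiv ℝ (F n)) := fun n => (hF n).fderiv_right (by norm_num)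
  have hd : ∀ n y, HasFDerivAt (F n) (fderiv ℝ (F n) y) y := fun n y =>
    ((hF n).differentiable (by norm_num) y).hasFDerivAt
  have hd1 : ∀ n y, HasFDerivAt (fderiv ℝ (F n)) (fderiv ℝ (fderiv ℝ (F n)) y) y := fun n y =>
    ((hF1 n).differentiable (by norm_num) y).hasFDerivAt
  have hnorm : ∀ n N y, ‖fderiv ℝ (fderiv ℝ (F N)) y - fderiv ℝ (fderiv ℝ (F n)) y‖ =
      ‖iteratedFDeriv ℝ 2 (fun x => F N x - F n x) y‖ := by
    intro n N y
    have e : fderiv ℝ (fun x => F N x - F n x) = fun y => fderiv ℝ (F N) y - fderiv ℝ (F n) y :=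
      funext fun y => ((hd N y).sub (hd n y)).fderiv
    rw [← norm_iteratedFDeriv_fderiv, norm_iteratedFDeriv_one, e,
      ((hd1 N y).fun_sub (hd1 n y)).fderiv]
  obtain ⟨g₁, g₂, hg₁, hc₁, ht₁, -, hcont⟩ := exists_tendsto_hasFDerivAt hd1
    (fun m => by
      rw [Metric.uniformCauchySeqOn_iff]
      intro ε hε
      obtain ⟨n, hn⟩ := hC m (ε / 3) (by positivity)
      refine ⟨n, fun N hN N' hN' y hy => ?_⟩
      have h1 := hn N hN y hy
      have h2 := hn N' hN' y hy
      rw [← hnorm, ← dist_eq_norm] at h1 h2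
      have := dist_triangle_right (fderiv ℝ (fderiv ℝ (F N)) y) (fderiv ℝ (fderiv ℝ (F N')) y)
        (fderiv ℝ (fderiv ℝ (F n)) y)
      linarith)
    (tendsto_const_nhds.congr' ((eventually_ge_atTop N₀).mono fun n hn =>
      ((h0 n hn).fderiv.self_of_nhds.symm))).cauchySeq
  obtain ⟨v, v', hv, -, htv, htv', -⟩ := exists_tendsto_hasFDerivAt hd hc₁
    (tendsto_const_nhds.congr' ((eventually_ge_atTop N₀).mono fun n hn =>
      ((h0 n hn).self_of_nhds.symm))).cauchySeq
  have he : v' = g₁ := funext fun y => tendsto_nhds_unique (htv' y) (ht₁ y)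
  subst he
  refine ⟨v, ?_, htv⟩
  have h2 : ContDiff ℝ 1 v' := contDiff_one_iff_hasFDerivAt.2
    ⟨g₂, hcont fun n => (hF1 n).continuous_fderiv (by norm_num), hg₁⟩
  exact contDiff_succ_iff_hasFDerivAt (n := 1).2 ⟨v', by exact_mod_cast h2, hv⟩

end Limit

section LocalSupport

/-- A continuous function with local affine supports is convex. -/
theorem convexOn_of_eventually_support {E : Type*} [NormedAddCommGroup E] [NormedSpace ℝ E]
    {f : E → ℝ} {s : Set E} (hs : Convex ℝ s) (hf : ContinuousOn f s)
    (h : ∀ x ∈ s, ∃ l : E →L[ℝ] ℝ, ∀ᶠ y in 𝓝 x, f x + l (y - x) ≤ f y) : ConvexOn ℝ s f := by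
  refine ⟨hs, fun a ha b hb p q hp hq hpq => ?_⟩
  set γ : ℝ → E := fun t => a + t • (b - a) with hγ
  have hγc : Continuous γ := by fun_prop
  have hγs : ∀ t ∈ Icc (0 : ℝ) 1, γ t ∈ s := fun t ht => by
    have e : γ t = (1 - t) • a + t • b := by simp only [hγ]; module
    rw [e]
    exact hs ha hb (by linarith [ht.2]) ht.1 (by ring)
  set φ : ℝ → ℝ := fun t => f (γ t) - (1 - t) * f a - t * f b with hφ
  have hφc : ContinuousOn φ (Icc 0 1) :=
    ((hf.comp hγc.continuousOn hγs).sub (by fun_prop)).sub (by fun_prop)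
  have h0 : φ 0 = 0 := by simp [hφ, hγ]
  have h1 : φ 1 = 0 := by simp [hφ, hγ]
  suffices hle : ∀ t ∈ Icc (0 : ℝ) 1, φ t ≤ 0 by
    have := hle q ⟨hq, by linarith⟩
    have e : γ q = p • a + q • b := by
      obtain rfl : p = 1 - q := by linarith
      simp only [hγ]; module
    simp only [hφ, e] at this
    obtain rfl : p = 1 - q := by linarith
    simp only [smul_eq_mul]
    linarith
  obtain ⟨t₁, ht₁, hmax⟩ := isCompact_Icc.exists_isMaxOn (nonempty_Icc.2 zero_le_one) hφc
  by_contra! hpos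
  obtain ⟨t₂, ht₂, hpos⟩ := hpos
  have hm : 0 < φ t₁ := hpos.trans_le (hmax ht₂)
  have hcl : IsClosed (Icc (0 : ℝ) 1 ∩ φ ⁻¹' {φ t₁}) :=
    hφc.preimage_isClosed_of_isClosed isClosed_Icc isClosed_singleton
  have hcpt : IsCompact (Icc (0 : ℝ) 1 ∩ φ ⁻¹' {φ t₁}) :=
    isCompact_Icc.of_isClosed_subset hcl inter_subset_left
  obtain ⟨t, ⟨ht, htm⟩, hleast⟩ := hcpt.exists_isLeast ⟨t₁, ht₁, rfl⟩
  rw [mem_preimage, mem_singleton_iff] at htm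
  have ht0 : 0 < t := lt_of_le_of_ne ht.1 (by rintro rfl; linarith)
  have ht1 : t < 1 := lt_of_le_of_ne ht.2 (by rintro rfl; linarith)
  obtain ⟨l, hl⟩ := h (γ t) (hγs t ht)
  have hev : ∀ᶠ τ in 𝓝 t, φ t + (l (b - a) + f a - f b) * (τ - t) ≤ φ τ := by
    filter_upwards [hγc.continuousAt.eventually hl] with τ hτ
    have e : γ τ - γ t = (τ - t) • (b - a) := by simp only [hγ]; module
    rw [e, map_smul, smul_eq_mul] at hτ
    simp only [hφ]
    linarith
  obtain ⟨δ, hδ, hball⟩ := Metric.eventually_nhds_iff.1 hev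
  set d := min (δ / 2) (min t (1 - t)) with hd
  have hd0 : 0 < d := lt_min (by positivity) (lt_min ht0 (by linarith))
  have hd1 : d ≤ δ / 2 := min_le_left _ _
  have hd2 : d ≤ t := (min_le_right _ _).trans (min_le_left _ _)
  have hd3 : d ≤ 1 - t := (min_le_right _ _).trans (min_le_right _ _)
  have hm1 : t - d ∈ Icc (0 : ℝ) 1 := ⟨by linarith, by linarith⟩
  have hm2 : t + d ∈ Icc (0 : ℝ) 1 := ⟨by linarith, by linarith⟩
  have hu := hball (y := t + d) (by
    rw [Real.dist_eq, add_sub_cancel_left, abs_of_pos hd0]; linarith)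
  have hv := hball (y := t - d)
    (by rw [Real.dist_eq, sub_sub_cancel_left, abs_neg, abs_of_pos hd0]; linarith)
  have hu' : φ (t + d) ≤ φ t₁ := hmax hm2
  have hv' : φ (t - d) ≤ φ t₁ := hmax hm1
  have hmem := hleast ⟨hm1, show φ (t - d) = φ t₁ by linarith⟩
  linarith

theorem eventually_abs_sub_le_mul_sq {E : Type*} [NormedAddCommGroup E] [NormedSpace ℝ E]
    {r : E → ℝ} (hr : ContDiff ℝ 2 r) {y : E} {A : ℝ} (hA : ‖iteratedFDeriv ℝ 2 r y‖ < A) :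
    ∀ᶠ x in 𝓝 y, |r x - r y - fderiv ℝ r y (x - y)| ≤ A * ‖x - y‖ ^ 2 := by
  have hr1 : ContDiff ℝ 1 (fderiv ℝ r) := hr.fderiv_right (by norm_num)
  have hd := (hr1.differentiable (by norm_num) y).hasFDerivAt
  have hA' : ‖fderiv ℝ (fderiv ℝ r) y‖ < A := by
    rwa [← norm_iteratedFDeriv_one, norm_iteratedFDeriv_fderiv]
  have hlip : ∀ᶠ x in 𝓝 y, ‖fderiv ℝ r x - fderiv ℝ r y‖ ≤ A * ‖x - y‖ := by
    filter_upwards [hd.isLittleO.def (sub_pos.2 hA')] with x hx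
    have h1 := (fderiv ℝ (fderiv ℝ r) y).le_opNorm (x - y)
    have h2 := norm_add_le (fderiv ℝ r x - fderiv ℝ r y - fderiv ℝ (fderiv ℝ r) y (x - y))
      (fderiv ℝ (fderiv ℝ r) y (x - y))
    rw [sub_add_cancel] at h2
    linarith
  obtain ⟨δ, hδ, hball⟩ := Metric.eventually_nhds_iff.1 hlip
  filter_upwards [ball_mem_nhds y hδ] with x hx
  have hmv := (convex_closedBall y ‖x - y‖).norm_image_sub_le_of_norm_hasFDerivWithin_le'
    (f := r) (f' := fderiv ℝ r) (φ := fderiv ℝ r y) (C := A * ‖x - y‖) (x := y) (y := x)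
    (fun z _ => ((hr.differentiable (by norm_num) z).hasFDerivAt).hasFDerivWithinAt)
    (fun z hz => by
      rw [mem_closedBall, dist_eq_norm] at hz
      have hA0 : 0 ≤ A := (norm_nonneg _).trans hA.le
      rw [mem_ball, dist_eq_norm] at hx
      refine (hball (by rw [dist_eq_norm]; linarith)).trans ?_
      gcongr)
    (mem_closedBall_self (norm_nonneg _)) (by rw [mem_closedBall, dist_eq_norm])
  rw [Real.norm_eq_abs] at hmv
  calc _ ≤ _ := hmv
    _ = _ := by ring

variable {E : Type*} [NormedAddCommGroup E] [InnerProductSpace ℝ E] [FiniteDimensional ℝ E]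
  [MeasurableSpace E] [BorelSpace E] (μ : Measure E) [μ.IsAddHaarMeasure]

theorem convexOn_mollify {φ : E → ℝ} (hφ : ConvexOn ℝ univ φ) (hφc : Continuous φ) :
    ConvexOn ℝ univ (mollify μ φ) := by
  refine ⟨convex_univ, fun p _ q _ a b ha hb hab => ?_⟩
  simp only [mollify, smul_eq_mul]
  rw [← integral_const_mul, ← integral_const_mul, ← integral_add]
  · refine integral_mono (integrable_mollifier_mul μ (by fun_prop)) (Integrable.add ?_ ?_)
      fun z => ?_
    · exact (integrable_mollifier_mul μ (by fun_prop)).const_mul _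
    · exact (integrable_mollifier_mul μ (by fun_prop)).const_mul _
    · have h := hφ.2 (mem_univ (p.2 - p.1 • z)) (mem_univ (q.2 - q.1 • z)) ha hb hab
      have e : (a • p + b • q).2 - (a • p + b • q).1 • z =
          a • (p.2 - p.1 • z) + b • (q.2 - q.1 • z) := by
        simp only [Prod.snd_add, Prod.smul_snd, Prod.fst_add, Prod.smul_fst, smul_eq_mul]
        module
      simp only [e]
      have := mul_le_mul_of_nonneg_left h (mollifier_nonneg μ z)
      simp only [smul_eq_mul] at this
      linarith
  · exact (integrable_mollifier_mul μ (by fun_prop)).const_mul _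
  · exact (integrable_mollifier_mul μ (by fun_prop)).const_mul _

theorem convexOn_mollify_sub_sq {u : E → ℝ} (huc : Continuous u) {η : ℝ} (hη : 0 ≤ η)
    (hu : ConvexOn ℝ univ fun x => u x - η / 2 * ‖x‖ ^ 2) :
    ConvexOn ℝ univ fun p : ℝ × E => mollify μ u p - η / 2 * ‖p.2‖ ^ 2 := by
  set c := ∫ z, mollifier μ z * ‖z‖ ^ 2 ∂μ with hc
  have hc0 : 0 ≤ c := integral_nonneg fun z => mul_nonneg (mollifier_nonneg μ z) (by positivity)
  have hq : ∀ p : ℝ × E, mollify μ (fun x => η / 2 * ‖x‖ ^ 2) p =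
      η / 2 * ‖p.2‖ ^ 2 + η / 2 * c * p.1 ^ 2 := by
    rintro ⟨s, y⟩
    have h := mollify_sub_self μ (g := fun x : E => η / 2 * ‖x‖ ^ 2) (by fun_prop) s y
    have e : ∀ z, mollifier μ z * (η / 2 * ‖y + s • z‖ ^ 2 + η / 2 * ‖y - s • z‖ ^ 2 -
        2 * (η / 2 * ‖y‖ ^ 2)) = mollifier μ z * ‖z‖ ^ 2 * (η * s ^ 2) := by
      intro z
      rw [norm_add_sq_real, norm_sub_sq_real, norm_smul, mul_pow, Real.norm_eq_abs, sq_abs]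
      ring
    simp only [e] at h
    rw [integral_mul_const, ← hc] at h
    simp only
    linarith
  have hsplit : (fun p : ℝ × E => mollify μ u p - η / 2 * ‖p.2‖ ^ 2) =
      fun p => mollify μ (fun x => u x - η / 2 * ‖x‖ ^ 2) p + η / 2 * c * p.1 ^ 2 := by
    funext p
    rw [mollify_sub μ huc (by fun_prop), hq]
    ring
  rw [hsplit]
  refine (convexOn_mollify μ hu (by fun_prop)).add ?_
  have h2 : ConvexOn ℝ univ fun p : ℝ × E => p.1 ^ 2 :=
    (even_two.convexOn_pow (𝕜 := ℝ)).comp_linearMap (LinearMap.fst ℝ ℝ E)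
  exact h2.smul (by positivity)

/-- Averaging at slowly varying scales preserves local supports of a strongly convex function up to
a small loss. -/
theorem exists_eventually_support_mollify {u : E → ℝ} (huc : Continuous u) {η η' : ℝ} (hη : 0 ≤ η)
    (hu : ConvexOn ℝ univ fun x => u x - η / 2 * ‖x‖ ^ 2) {r : E → ℝ} (hr : ContDiff ℝ 2 r) {y : E}
    (hr0 : 0 < r y) {R D : ℝ} (hrR : r y ≤ R)
    (hD : ∀ h, ‖h‖ ≤ 2 * R → u (y + h) + u (y - h) - 2 * u y ≤ D)
    (hRD : D / (2 * R) * ‖iteratedFDeriv ℝ 2 r y‖ < (η - η') / 2) :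
    ∃ l : E →L[ℝ] ℝ, ∀ᶠ x in 𝓝 y, mollify μ u (r y, y) - η' / 2 * ‖y‖ ^ 2 + l (x - y) ≤
      mollify μ u (r x, x) - η' / 2 * ‖x‖ ^ 2 := by
  have hR : 0 < R := hr0.trans_le hrR
  have hconv := convexOn_mollify_sub_sq μ huc hη hu
  obtain ⟨L, hL⟩ := hconv.exists_le_add_clm (r y, y)
  set σ := L (1, 0) with hσ
  have hLs : ∀ (s : ℝ) (h : E), L (s, h) = s * σ + L (0, h) := fun s h => by
    have : ((s, h) : ℝ × E) = s • (1, 0) + (0, h) := by simp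
    rw [this, map_add, map_smul, smul_eq_mul]
  have hL0 : L (0, 0) = 0 := map_zero L
  have heven : mollify μ u (-r y, y) = mollify μ u (r y, y) := by
    have h1 := mollify_sub_self μ huc (-r y) y
    have h2 := mollify_sub_self μ huc (r y) y
    simp only [neg_smul, sub_neg_eq_add, ← sub_eq_add_neg] at h1
    have e : ∀ z, u (y - r y • z) + u (y + r y • z) - 2 * u y =
      u (y + r y • z) + u (y - r y • z) - 2 * u y := fun z => by ring
    simp only [e] at h1
    linarith
  have hσ0 : 0 ≤ σ := by
    have := hL (-r y, y)
    simp only [Prod.mk_sub_mk, sub_self, heven] at this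
    rw [hLs, hL0] at this
    nlinarith
  have hσD : σ ≤ D / (2 * R) := by
    have h1 := hL (r y + R, y)
    simp only [Prod.mk_sub_mk, sub_self, add_sub_cancel_left] at h1
    rw [hLs, hL0] at h1
    have h2 : mollify μ u (r y + R, y) - u y ≤ 1 / 2 * D := mollify_sub_self_le μ huc fun z hz =>
      hD _ (by
        rw [norm_smul, Real.norm_of_nonneg (by positivity)]
        nlinarith)
    have h3 : u y ≤ mollify μ u (r y, y) := by
      have h4 := hconv.2 (mem_univ (r y, y)) (mem_univ (-r y, y))
        (show (0 : ℝ) ≤ 1 / 2 by norm_num) (show (0 : ℝ) ≤ 1 / 2 by norm_num) (by norm_num)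
      have e : (1 / 2 : ℝ) • (r y, y) + (1 / 2 : ℝ) • (-r y, y) = (0, y) := by
        ext1
        · simp
        · simp only [Prod.snd_add, Prod.smul_snd]; module
      rw [e] at h4
      simp only [heven, mollify_zero_left, smul_eq_mul] at h4
      linarith
    rw [le_div_iff₀ (by positivity)]
    linarith
  obtain ⟨A, hA1, hA2⟩ : ∃ A, ‖iteratedFDeriv ℝ 2 r y‖ < A ∧ D / (2 * R) * A < (η - η') / 2 := by
    have hev : ∀ᶠ A in 𝓝[>] ‖iteratedFDeriv ℝ 2 r y‖, D / (2 * R) * A < (η - η') / 2 :=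
      ((continuous_const.mul continuous_id).tendsto _ |>.mono_left nhdsWithin_le_nhds).eventually
        (gt_mem_nhds hRD)
    obtain ⟨A, h1, h2⟩ := (hev.and self_mem_nhdsWithin).exists
    exact ⟨A, h2, h1⟩
  refine ⟨σ • fderiv ℝ r y + L.comp (ContinuousLinearMap.inr ℝ ℝ E) + (η - η') • innerSL ℝ y, ?_⟩
  filter_upwards [eventually_abs_sub_le_mul_sq hr hA1] with x hx
  have h1 := hL (r x, x)
  simp only [Prod.mk_sub_mk] at h1
  rw [hLs] at h1
  have h2 : ‖x‖ ^ 2 = ‖y‖ ^ 2 + 2 * ⟪y, x - y⟫_ℝ + ‖x - y‖ ^ 2 := by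
    rw [← norm_add_sq_real, add_sub_cancel]
  have h3 := mul_le_mul_of_nonneg_left (abs_le.1 hx).1 hσ0
  have hA0 : 0 ≤ A := (norm_nonneg _).trans hA1.le
  have h4 : σ * A ≤ (η - η') / 2 := (mul_le_mul_of_nonneg_right hσD hA0).trans hA2.le
  have h5 := mul_le_mul_of_nonneg_right h4 (sq_nonneg ‖x - y‖)
  simp only [FunLike.coe_add, FunLike.coe_smul, Pi.add_apply, Pi.smul_apply, smul_eq_mul,
    ContinuousLinearMap.coe_comp, Function.comp_apply, ContinuousLinearMap.inr_apply,
    innerSL_apply_apply]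
  rw [h2] at h1 ⊢
  linarith

theorem secondDiff_le_of_near {u : E → ℝ} (hu : ConvexOn ℝ univ u) {x y : E} {M R : ℝ} (hM : 0 ≤ M)
    (hR : R ≤ 1) (hxy : ‖y - x‖ ≤ R)
    (hx : ∀ h, ‖h‖ ≤ 4 → u (x + h) + u (x - h) - 2 * u x ≤ M * ‖h‖ ^ 2) {h : E}
    (hh : ‖h‖ ≤ 2 * R) : u (y + h) + u (y - h) - 2 * u y ≤ 18 * M * R ^ 2 := by
  obtain ⟨l, hl⟩ := hu.exists_le_add_clm x
  have hup : ∀ k : E, ‖k‖ ≤ 3 * R → u (x + k) ≤ u x + l k + M * (3 * R) ^ 2 := by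
    intro k hk
    have h1 := hx k (by linarith)
    have h2 := hl (x - k)
    rw [sub_sub_cancel_left, map_neg] at h2
    have h3 : M * ‖k‖ ^ 2 ≤ M * (3 * R) ^ 2 := by gcongr
    linarith
  have h1 := hup (y - x + h) ((norm_add_le _ _).trans (by linarith))
  have h2 := hup (y - x - h) ((norm_sub_le _ _).trans (by linarith))
  have h3 := hl y
  rw [show x + (y - x + h) = y + h by abel, map_add] at h1
  rw [show x + (y - x - h) = y - h by abel, map_sub] at h2
  linarith

end LocalSupport

section Approximation

variable {E : Type*} [NormedAddCommGroup E] [InnerProductSpace ℝ E] [FiniteDimensional ℝ E]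
  [MeasurableSpace E] [BorelSpace E] (μ : Measure E) [μ.IsAddHaarMeasure]

variable (E) in
theorem exists_norm_iteratedFDeriv_mollify_sub_taylor_le :
    ∃ C : ℝ, 0 ≤ C ∧ ∀ u : E → ℝ, Continuous u → ∀ r : E → ℝ, ContDiff ℝ 2 r →
      (∀ y, 0 < r y) → ∀ (ξ : E →L[ℝ] ℝ) (Q : E →L[ℝ] E →L[ℝ] ℝ) (x y : E) (κ c R M : ℝ),
      0 < κ → κ ≤ 1 → 0 < c → 0 < R → 0 ≤ M → (∀ h, |Q h h| ≤ M * ‖h‖ ^ 2) →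
      (∀ h, ‖h‖ ≤ 4 * R → |taylorRem u x ξ Q h| ≤ κ ^ 3 * ‖h‖ ^ 2) →
      ‖iteratedFDeriv ℝ 1 r y‖ ≤ κ → r y * ‖iteratedFDeriv ℝ 2 r y‖ ≤ κ →
      ‖y - x‖ ≤ R → r y ≤ R → c * κ * R / 4 ≤ r y →
      ‖iteratedFDeriv ℝ 2 (fun z => mollify μ u (r z, z) - quadPoly (u x) ξ Q x z) y‖ ≤
        (C / c ^ 2 + 2 * M) * κ := by
  obtain ⟨C, hC, h⟩ := exists_norm_iteratedFDeriv_mollify_sub_quadPoly_le E μ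
  refine ⟨144 * C, by positivity, ?_⟩
  intro u hu r hr hr0 ξ Q x y κ c R M hκ hκ1 hc hR hM hQ hT h1 h2 hxy hrR hrc
  have hG : ∀ z ∈ closedBall y (2 * r y), |u z - quadPoly (u x) ξ Q x z| ≤ 9 * κ ^ 3 * R ^ 2 := by
    intro z hz
    rw [mem_closedBall, dist_eq_norm] at hz
    have hzx : ‖z - x‖ ≤ 3 * R := by
      have := norm_add_le (z - y) (y - x)
      rw [sub_add_sub_cancel] at this
      linarith
    have hT' := hT (z - x) (by linarith)
    have e : taylorRem u x ξ Q (z - x) = u z - quadPoly (u x) ξ Q x z := by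
      simp only [taylorRem, quadPoly, add_sub_cancel]
      ring
    rw [e] at hT'
    calc _ ≤ κ ^ 3 * ‖z - x‖ ^ 2 := hT'
      _ ≤ κ ^ 3 * (3 * R) ^ 2 := by gcongr
      _ = _ := by ring
  refine (h u hu r hr hr0 (u x) ξ Q x y κ _ M hκ.le hκ1 hM hQ h1 h2 hG).trans ?_
  have : C * (9 * κ ^ 3 * R ^ 2) / r y ^ 2 ≤ C * (9 * κ ^ 3 * R ^ 2) / (c * κ * R / 4) ^ 2 := by
    gcongr
  have e : C * (9 * κ ^ 3 * R ^ 2) / (c * κ * R / 4) ^ 2 = 144 * C / c ^ 2 * κ := by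
    field_simp
    ring
  linarith

theorem exists_antitone_pos_small {C τ : ℝ} (hC : 0 ≤ C) (hτ : 0 < τ) {M : ℕ → ℝ}
    (hM : ∀ m, 0 ≤ M m) : ∃ c : ℕ → ℝ, Antitone c ∧ (∀ m, 0 < c m) ∧ (∀ m, c m ≤ 1) ∧
      (∀ m, C * c m ≤ 1) ∧ ∀ m, M m * c m < τ := by
  have hS : ∀ m, 0 ≤ ∑ j ∈ Finset.range (m + 1), M j / τ := fun m =>
    Finset.sum_nonneg fun j _ => div_nonneg (hM j) hτ.le
  have hpos : ∀ m, 0 < 1 + C + ∑ j ∈ Finset.range (m + 1), M j / τ := fun m => by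
    have := hS m; linarith
  refine ⟨fun m => 1 / (1 + C + ∑ j ∈ Finset.range (m + 1), M j / τ), ?_, fun m => ?_, fun m => ?_,
    fun m => ?_, fun m => ?_⟩
  · refine antitone_nat_of_succ_le fun m => ?_
    refine one_div_le_one_div_of_le (hpos m) ?_
    rw [Finset.sum_range_succ _ (m + 1)]
    have := div_nonneg (hM (m + 1)) hτ.le
    linarith
  · exact one_div_pos.2 (hpos m)
  · rw [div_le_one (hpos m)]
    have := hS m; linarith
  · rw [mul_one_div, div_le_one (hpos m)]
    have := hS m; linarith
  · rw [mul_one_div, div_lt_iff₀ (hpos m), Finset.sum_range_succ, mul_add, mul_add, mul_add,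
      mul_div_cancel₀ _ hτ.ne']
    have : 0 ≤ ∑ j ∈ Finset.range m, M j / τ :=
      Finset.sum_nonneg fun j _ => div_nonneg (hM j) hτ.le
    have := mul_nonneg hτ.le hC
    have h2 : 0 ≤ τ * ∑ j ∈ Finset.range m, M j / τ := by positivity
    linarith

theorem infDist_le_one_of_measure_compl_lt {K : Set E} (hK : μ Kᶜ < μ (ball 0 1)) (y : E) :
    infDist y K ≤ 1 := by
  by_contra! h
  have hsub : ball y 1 ⊆ Kᶜ := fun x hx hxK => by
    have := infDist_le_dist_of_mem (x := y) hxK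
    rw [mem_ball, dist_comm] at hx
    linarith
  have := measure_mono (μ := μ) hsub
  rw [Measure.addHaar_ball_center] at this
  exact absurd hK (not_lt.2 this)

theorem exists_contDiff_two_stronglyConvex_approx [Nontrivial E] {u : E → ℝ} {η η' : ℝ}
    (hη : 0 < η) (hη' : η' < η) (hu : ConvexOn ℝ univ fun x => u x - η / 2 * ‖x‖ ^ 2) {ε : ℝ≥0∞}
    (hε : ε ≠ 0) : ∃ v : E → ℝ, ContDiff ℝ 2 v ∧
      (ConvexOn ℝ univ fun x => v x - η' / 2 * ‖x‖ ^ 2) ∧ μ {x | u x ≠ v x} < ε := by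
  have huc : Continuous u := by
    have h : Continuous fun x => u x - η / 2 * ‖x‖ ^ 2 := hu.locallyLipschitz.continuous
    have h2 := h.add (by fun_prop : Continuous fun x : E => η / 2 * ‖x‖ ^ 2)
    convert h2 using 1
    funext x
    simp
  have hucv : ConvexOn ℝ univ u := by
    have h := hu.add (((convexOn_norm convex_univ).pow (fun x _ => norm_nonneg x) 2).smul
      (by positivity : 0 ≤ η / 2))
    refine h.congr fun x _ => ?_
    simp
  obtain ⟨K, hKc, hKε, hK0, J, M, ξ, Q, hJ, hJmono, hJs, hM, hKT⟩ :=
    exists_isClosed_uniform_taylor μ huc (alexandrov_of_stronglyConvex μ hη hu)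
      (ε := min ε (μ (ball 0 1)))
      (lt_min (pos_iff_ne_zero.2 hε) (measure_ball_pos μ 0 one_pos)).ne'
  have hKball : μ Kᶜ < μ (ball 0 1) := hKε.trans_le (min_le_right _ _)
  have hK1 := infDist_le_one_of_measure_compl_lt μ hKball
  have hKne : K.Nonempty := by
    rw [nonempty_iff_ne_empty]
    rintro rfl
    rw [compl_empty] at hKball
    exact absurd hKball (not_lt.2 (measure_mono (subset_univ _)))
  obtain ⟨C, hC, hrad⟩ := exists_contDiff_radii E
  obtain ⟨C₂, hC₂, hmol⟩ := exists_norm_iteratedFDeriv_mollify_sub_taylor_le E μ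
  obtain ⟨c, hc, hc0, hc1, hcC, hcM⟩ := exists_antitone_pos_small (M := fun m => 9 * M (m + 2) * C)
    hC (show 0 < (η - η') / 2 by linarith) (fun m => by have := hM (m + 2); positivity)
  set κ : ℕ → ℝ := fun k => 1 / ((J k : ℝ) + 1) with hκ
  have hκ0 : ∀ k, 0 < κ k := fun k => by positivity
  have hκ1 : ∀ k, κ k ≤ 1 := fun k => by
    rw [hκ, div_le_one (by positivity)]
    have : (0 : ℝ) ≤ J k := by positivity
    linarith
  have hκa : Antitone κ := fun i j hij => by
    have : (J i : ℝ) ≤ J j := by exact_mod_cast hJmono hij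
    exact one_div_le_one_div_of_le (by positivity) (by linarith)
  have hκs : ∀ k, κ k / 2 ≤ κ (k + 1) := fun k => by
    have : (J (k + 1) : ℝ) ≤ J k + 1 := by exact_mod_cast hJs k
    rw [hκ, div_div]
    refine one_div_le_one_div_of_le (by positivity) ?_
    have : (0 : ℝ) ≤ J k := by positivity
    linarith
  have hκt : Tendsto κ atTop (𝓝 0) := tendsto_one_div_add_atTop_nhds_zero_nat.comp hJ
  obtain ⟨r, hr, hr0, hrl, hrs⟩ := hrad K hK1 κ c hκa hκ0 hc hc0
  set w : ℕ → E → ℝ := fun N y => mollify μ u (r N y, y) with hw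
  have hwc : ∀ N, ContDiff ℝ 2 (w N) := fun N => contDiff_mollify_comp μ huc (hr N) (hr0 N)
  have hws : ∀ (N N' : ℕ) y, N ≤ N' → ‖y‖ < N → (1 / 2) ^ N < infDist y K →
      w N' =ᶠ[𝓝 y] w N := fun N N' y h1 h2 h3 =>
    (hrs N N' y h1 h2 h3).mono fun z hz => by simp only [hw, hz]
  have hcκ : ∀ m k, c m * κ k ≤ κ k := fun m k => mul_le_of_le_one_left (hκ0 k).le (hc1 m)
  have hrR : ∀ m k, c m * (κ k * (1 / 2) ^ k) ≤ (1 / 2) ^ k := fun m k => by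
    rw [← mul_assoc]
    exact mul_le_of_le_one_left (by positivity) ((hcκ m k).trans (hκ1 k))
  have hCcκ : ∀ m k, C * (c m * κ k) ≤ κ k := fun m k => by
    rw [← mul_assoc]
    exact mul_le_of_le_one_left (hκ0 k).le (hcC m)
  have hnear : ∀ y, ∃ x ∈ K, infDist y K = ‖y - x‖ := fun y => by
    simpa only [dist_eq_norm] using hKc.exists_infDist_eq_dist hKne y
  -- second derivatives are governed by the Taylor polynomial at a nearest point of `K`
  have hclose : ∀ m₀ : ℕ, ∃ A, ∀ n N, n ≤ N → m₀ + 1 ≤ J n → ∀ y, ‖y‖ < m₀ →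
      infDist y K ≤ (1 / 2) ^ n → ∀ x ∈ K, infDist y K = ‖y - x‖ →
      ‖iteratedFDeriv ℝ 2 (fun z => w N z - quadPoly (u x) (ξ x) (Q x) x z) y‖ ≤ A * κ n := by
    intro m₀
    refine ⟨C₂ / c m₀ ^ 2 + 2 * M (m₀ + 1), fun n N hnN hJn y hy hyn x hx hyx => ?_⟩
    obtain ⟨m, hmN, k, hkN, hm, -, hk, hk', hlo, hup, hD1, hD2⟩ := hrl N y
    have hnk : n ≤ k := by
      rcases hkN.lt_or_eq with h | h
      · have h1 := (hk' h).trans_le hyn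
        have := (pow_lt_pow_iff_right_of_lt_one₀ (by norm_num : (0 : ℝ) < 1 / 2)
          (by norm_num)).1 h1
        omega
      · omega
    have hmm : m + 1 ≤ m₀ := by
      have : (m : ℝ) < m₀ := hm.trans_lt hy
      exact_mod_cast this
    have hxm : ‖x‖ < (m₀ + 1 : ℕ) := by
      have h1 := norm_sub_norm_le x y
      rw [norm_sub_rev, ← hyx] at h1
      have := hK1 y
      push_cast
      linarith
    obtain ⟨hQ, -, hT⟩ := hKT x hx
    have hxJ : ‖x‖ < J k := hxm.trans_le (by exact_mod_cast hJn.trans (hJmono hnk))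
    have hA : 0 ≤ C₂ / c m₀ ^ 2 + 2 * M (m₀ + 1) := by have := hM (m₀ + 1); positivity
    refine (hmol u huc (r N) (hr N) (hr0 N) (ξ x) (Q x) x y (κ k) (c m₀) ((1 / 2) ^ k)
      (M (m₀ + 1)) (hκ0 k) (hκ1 k) (hc0 m₀) (by positivity) (hM _) (hQ _ hxm) (hT k hxJ)
      (hD1.trans (hCcκ m k)) ?_ (hyx ▸ hk) (hup.trans (hrR m k)) ?_).trans
      (mul_le_mul_of_nonneg_left (hκa hnk) hA)
    · calc r N y * ‖iteratedFDeriv ℝ 2 (r N) y‖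
          ≤ (1 / 2) ^ k * (C * (c m * κ k) / (1 / 2) ^ k) :=
            mul_le_mul (hup.trans (hrR m k)) hD2 (norm_nonneg _) (by positivity)
        _ = C * (c m * κ k) := by field_simp
        _ ≤ κ k := hCcκ m k
    · calc c m₀ * κ k * (1 / 2) ^ k / 4 = c m₀ * (κ k / 2 * (1 / 2) ^ (k + 1)) := by ring
        _ ≤ c (m + 1) * (κ (k + 1) * (1 / 2) ^ (k + 1)) := by
          have h1 := hκ0 (k + 1)
          have h2 := hκ0 k
          exact mul_le_mul (hc hmm) (mul_le_mul_of_nonneg_right (hκs k) (by positivity))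
            (by positivity) (hc0 (m + 1)).le
        _ ≤ r N y := hlo
  obtain ⟨N₀, hN₀⟩ : ∃ N₀ : ℕ, (1 / 2 : ℝ) ^ (N₀ + 1) < infDist 0 K := by
    obtain ⟨N, hN⟩ := exists_pow_lt_of_lt_one ((hKc.notMem_iff_infDist_pos hKne).1 hK0)
      (by norm_num : (1 / 2 : ℝ) < 1)
    exact ⟨N, (pow_le_pow_of_le_one (by norm_num) (by norm_num) N.le_succ).trans_lt hN⟩
  obtain ⟨v, hv, hwv⟩ := exists_contDiff_two_tendsto hwc (N₀ := N₀ + 1)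
    (fun n hn => hws (N₀ + 1) n 0 hn (by rw [norm_zero]; positivity) hN₀) (by
      intro m δ hδ
      obtain ⟨A, hA⟩ := hclose m
      have hlim : Tendsto (fun n => 2 * A * κ n) atTop (𝓝 0) := by
        simpa using hκt.const_mul (2 * A)
      obtain ⟨n, hn1, hn2, hn3⟩ := ((hlim.eventually_le_const hδ).and
        ((eventually_ge_atTop m).and (hJ.eventually_ge_atTop (m + 1)))).exists
      refine ⟨n, fun N hN y hy => ?_⟩
      rw [mem_ball_zero_iff] at hy
      rcases lt_or_ge ((1 / 2 : ℝ) ^ n) (infDist y K) with h | h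
      · have hev : (fun x => w N x - w n x) =ᶠ[𝓝 y] fun _ => 0 :=
          (hws n N y hN (hy.trans_le (by exact_mod_cast hn2)) h).mono fun z hz => by simp [hz]
        rw [(hev.iteratedFDeriv ℝ 2).self_of_nhds, iteratedFDeriv_const_of_ne two_ne_zero]
        simpa using hδ.le
      · obtain ⟨x, hx, hyx⟩ := hnear y
        have h1 := hA n N hN hn3 y hy h x hx hyx
        have h2 := hA n n le_rfl hn3 y hy h x hx hyx
        have hp := contDiff_quadPoly (u x) (ξ x) (Q x) x
        have e : (fun z => w N z - w n z) = (fun z => w N z - quadPoly (u x) (ξ x) (Q x) x z) -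
            fun z => w n z - quadPoly (u x) (ξ x) (Q x) x z := by
          funext z; simp
        rw [e, iteratedFDeriv_sub_apply ((hwc N).sub hp).contDiffAt ((hwc n).sub hp).contDiffAt]
        refine (norm_sub_le _ _).trans ?_
        linarith)
  have hwconv : ∀ N : ℕ, ConvexOn ℝ (ball 0 N) fun y => w N y - η' / 2 * ‖y‖ ^ 2 := by
    intro N
    refine convexOn_of_eventually_support (convex_ball _ _)
      (((hwc N).continuous.sub (by fun_prop)).continuousOn) fun y hy => ?_
    rw [mem_ball_zero_iff] at hy
    obtain ⟨m, hmN, k, hkN, hm, hm', hk, -, -, hup, -, hD2⟩ := hrl N y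
    have hmlt : m < N := by
      have : (m : ℝ) < N := hm.trans_lt hy
      exact_mod_cast this
    obtain ⟨x, hx, hyx⟩ := hnear y
    have hxm : ‖x‖ < (m + 2 : ℕ) := by
      have h1 := norm_sub_norm_le x y
      rw [norm_sub_rev, ← hyx] at h1
      have := hK1 y
      have := hm' hmlt
      push_cast
      linarith
    have hMm := hM (m + 2)
    refine exists_eventually_support_mollify μ huc hη.le hu (hr N) (hr0 N y) (R := (1 / 2) ^ k)
      (D := 18 * M (m + 2) * ((1 / 2) ^ k) ^ 2) (hup.trans (hrR m k))
      (fun h hh => secondDiff_le_of_near hucv hMm (pow_le_one₀ (by norm_num) (by norm_num))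
        (hyx ▸ hk) ((hKT x hx).2.1 _ hxm) hh) ?_
    have hR : (0 : ℝ) < (1 / 2) ^ k := by positivity
    set R : ℝ := (1 / 2) ^ k
    calc 18 * M (m + 2) * R ^ 2 / (2 * R) * ‖iteratedFDeriv ℝ 2 (r N) y‖
        ≤ 18 * M (m + 2) * R ^ 2 / (2 * R) * (C * (c m * κ k) / R) := by gcongr
      _ = 9 * M (m + 2) * C * (c m * κ k) := by field_simp; ring
      _ ≤ 9 * M (m + 2) * C * (c m * 1) := by
        have := hc0 m
        gcongr
        exact hκ1 k
      _ < (η - η') / 2 := by rw [mul_one]; exact hcM m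
  refine ⟨v, hv, ⟨convex_univ, fun a _ b _ p q hp hq hpq => ?_⟩, ?_⟩
  · have ht : ∀ y, Tendsto (fun N => w N y - η' / 2 * ‖y‖ ^ 2) atTop
        (𝓝 (v y - η' / 2 * ‖y‖ ^ 2)) := fun y => (hwv y).sub_const _
    refine le_of_tendsto_of_tendsto (ht _) (((ht a).const_smul p).add ((ht b).const_smul q)) ?_
    obtain ⟨N₁, hN₁⟩ := exists_nat_gt (max ‖a‖ ‖b‖)
    filter_upwards [eventually_ge_atTop N₁] with N hN
    have hN' : max ‖a‖ ‖b‖ < N := hN₁.trans_le (by exact_mod_cast hN)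
    exact (hwconv N).2 (mem_ball_zero_iff.2 ((le_max_left _ _).trans_lt hN'))
      (mem_ball_zero_iff.2 ((le_max_right _ _).trans_lt hN')) hp hq hpq
  · refine (measure_mono (show {x | u x ≠ v x} ⊆ Kᶜ from fun x hx hxK => hx ?_)).trans_lt
      (hKε.trans_le (min_le_left _ _))
    have hrx : ∀ N, r N x ≤ (1 / 2) ^ N := by
      intro N
      obtain ⟨m, -, k, hkN, -, -, -, hk, -, hup, -⟩ := hrl N x
      have hkN' : k = N := by
        by_contra hne
        have := hk (lt_of_le_of_ne hkN hne)
        rw [infDist_zero_of_mem hxK] at this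
        exact absurd this (not_lt.2 (by positivity))
      subst hkN'
      exact hup.trans (hrR m k)
    have hr_lim : Tendsto (fun N => r N x) atTop (𝓝 0) :=
      squeeze_zero (fun N => (hr0 N x).le) hrx
        (tendsto_pow_atTop_nhds_zero_of_lt_one (by norm_num) (by norm_num))
    have h1 : Tendsto (fun N => w N x) atTop (𝓝 (mollify μ u (0, x))) :=
      ((continuous_mollify μ huc).tendsto _).comp (hr_lim.prodMk_nhds tendsto_const_nhds)
    rw [mollify_zero_left] at h1
    exact tendsto_nhds_unique h1 (hwv x)

end Approximation

/-- Lusin-type approximation of strongly convex functions by `C²` strongly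
convex functions. -/
theorem strongly_convex_C2_lusin_approx {n : ℕ}
    (u : EuclideanSpace ℝ (Fin n) → ℝ) (η : ℝ) (hη : 0 < η)
    (hu : StronglyConvexWith η u)
    (ε : ℝ) (hε : 0 < ε) (η' : ℝ) (hη' : 0 < η') (hη'η : η' < η) :
    ∃ v : EuclideanSpace ℝ (Fin n) → ℝ,
      ContDiff ℝ 2 v ∧ StronglyConvexWith η' v ∧
      volume {x | u x ≠ v x} < ENNReal.ofReal ε := by
  rcases subsingleton_or_nontrivial (EuclideanSpace ℝ (Fin n)) with h | h
  · refine ⟨u, ?_, ?_, by simpa using hε⟩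
    · rw [show u = fun _ => u 0 from funext fun x => by rw [Subsingleton.elim x 0]]
      exact contDiff_const
    have h0 : ∀ x : EuclideanSpace ℝ (Fin n), ‖x‖ = 0 := fun x => by
      rw [Subsingleton.elim x 0, norm_zero]
    simpa [StronglyConvexWith, h0] using hu
  · exact exists_contDiff_two_stronglyConvex_approx volume hη hη'η hu
      (ENNReal.ofReal_pos.2 hε).ne'
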